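/- arXiv:math/0605294 — 6 statements merged into one kernel-verified Lean document; each statement's English description precedes it below -/
import Mathlib

section
/- A tree G has greatest spectral radius in the class of all trees with n vertices and exactly k leaves if and only if G is a spider obtained from a star K_{1,k} by attaching paths of almost the same lengths (any two path lengths differing by at most 1) to each of its k leaves. -/
open Finset

variable {V : Type*} {W : Type*}

/-- The adjacency matrix of a finite simple graph, with real entries. -/
noncomputable def adjMat [Fintype V] (G : SimpleGraph V) : Matrix V V ℝ :=
  letI := Classical.decRel G.Adj
  G.adjMatrix ℝ

/-- The spectral radius `λ(G)`: the largest eigenvalue of the adjacency matrix. -/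
noncomputable def specRad [Fintype V] (G : SimpleGraph V) : ℝ :=
  sSup {μ : ℝ | ∃ f : V → ℝ, f ≠ 0 ∧ (adjMat G).mulVec f = μ • f}

/-- The degree of a vertex. -/
noncomputable def deg [Fintype V] (G : SimpleGraph V) (v : V) : ℕ :=
  letI := Classical.decRel G.Adj
  G.degree v

/-- The degree sequence of `G`, as a multiset. -/
noncomputable def degMultiset [Fintype V] (G : SimpleGraph V) : Multiset ℕ :=
  Finset.univ.val.map (deg G)

/-- `G` has the degree sequence `d` (a sequence of length `n`). -/
def hasDegSeq [Fintype V] (G : SimpleGraph V) {n : ℕ} (d : Fin n → ℕ) : Prop :=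
  Finset.univ.val.map d = degMultiset G

/-- `f` is the Perron vector of `G`: a positive unit eigenvector for the
largest eigenvalue. -/
def IsPerronVector [Fintype V] (G : SimpleGraph V) (f : V → ℝ) : Prop :=
  (∀ v, 0 < f v) ∧ (∑ v, f v ^ 2 = 1) ∧ (adjMat G).mulVec f = specRad G • f

/-- `N_f(v) = Σ_{u ∼ v} f(u)`. -/
noncomputable def Nf [Fintype V] (G : SimpleGraph V) (f : V → ℝ) (v : V) : ℝ :=
  letI := Classical.decRel G.Adj
  ∑ u ∈ G.neighborFinset v, f u

/-- `w` is the parent of `v` w.r.t. the ordering `ord` (with root `ord.symm 0`):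
`w` is the `ord`-least neighbor of `v` whose height is one less than that of `v`. -/
def IsParent [Fintype V] [Nonempty V] (G : SimpleGraph V)
    (ord : V ≃ Fin (Fintype.card V)) (w v : V) : Prop :=
  G.Adj w v ∧ G.dist (ord.symm ⟨0, Fintype.card_pos⟩) w + 1
      = G.dist (ord.symm ⟨0, Fintype.card_pos⟩) v ∧
    ∀ w' : V, G.Adj w' v →
      G.dist (ord.symm ⟨0, Fintype.card_pos⟩) w' + 1
        = G.dist (ord.symm ⟨0, Fintype.card_pos⟩) v → ord w ≤ ord w'

/-- `ord` is a breadth-first search ordering with decreasing degrees (BFD-ordering):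
vertices are listed layer by layer by distance from the root (the `ord`-least vertex),
(B1) children of earlier parents come before children of later parents, and
(B2) earlier vertices have larger or equal degrees. -/
def IsBFDOrdering [Fintype V] [Nonempty V] (G : SimpleGraph V)
    (ord : V ≃ Fin (Fintype.card V)) : Prop :=
  (∀ u v : V, ord u ≤ ord v →
      G.dist (ord.symm ⟨0, Fintype.card_pos⟩) u
        ≤ G.dist (ord.symm ⟨0, Fintype.card_pos⟩) v) ∧
  (∀ w1 w2 v1 v2 : V, ord w1 < ord w2 →
      IsParent G ord w1 v1 → IsParent G ord w2 v2 → ord v1 < ord v2) ∧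
  (∀ u v : V, ord u < ord v → deg G v ≤ deg G u)

/-- A tree degree sequence: non-increasing, positive entries, summing to `2(n-1)`. -/
def IsTreeDegSeq {n : ℕ} (d : Fin n → ℕ) : Prop :=
  Antitone d ∧ (∀ i, 0 < d i) ∧ ∑ i, d i = 2 * (n - 1)

/-- `Σ_{uv ∈ E(G)} f(u) f(v)`. -/
noncomputable def edgeSum [Fintype V] [DecidableEq V] (G : SimpleGraph V) (f : V → ℝ) : ℝ :=
  letI := Classical.decRel G.Adj
  ∑ e ∈ G.edgeFinset, Sym2.lift ⟨fun u v => f u * f v, fun u v => mul_comm (f u) (f v)⟩ e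

/-- The graph obtained from `G` by switching: replacing edges `v1u1`, `v2u2`
by `v1v2`, `u1u2`. -/
noncomputable def switched (G : SimpleGraph V) (v1 u1 v2 u2 : V) : SimpleGraph V :=
  SimpleGraph.fromEdgeSet ((G.edgeSet \ {s(v1, u1), s(v2, u2)}) ∪ {s(v1, v2), s(u1, u2)})

/-- The graph obtained from `G` by shifting: replacing the edge `uv1` by `uv2`. -/
noncomputable def shifted (G : SimpleGraph V) (u v1 v2 : V) : SimpleGraph V :=
  SimpleGraph.fromEdgeSet ((G.edgeSet \ {s(u, v1)}) ∪ {s(u, v2)})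

namespace BalancedSpider

open Matrix

section Spectral

theorem adjMat_apply [Fintype V] (G : SimpleGraph V) (u v : V) [Decidable (G.Adj u v)] :
    adjMat G u v = if G.Adj u v then 1 else 0 := by
  unfold adjMat
  rw [SimpleGraph.adjMatrix_apply]
  congr

theorem adjMat_comm [Fintype V] (G : SimpleGraph V) (u v : V) :
    adjMat G u v = adjMat G v u := by
  classical
  simp [adjMat_apply, G.adj_comm]

theorem adjMat_nonneg [Fintype V] (G : SimpleGraph V) (u v : V) : 0 ≤ adjMat G u v := by
  classical
  rw [adjMat_apply]
  split_ifs <;> norm_num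

theorem adjMat_isHermitian [Fintype V] (G : SimpleGraph V) : (adjMat G).IsHermitian := by
  ext u v
  simp [adjMat_comm G u v]

theorem finite_eigenvalues [Fintype V] (A : Matrix V V ℝ) :
    {μ : ℝ | ∃ f : V → ℝ, f ≠ 0 ∧ A *ᵥ f = μ • f}.Finite := by
  classical
  refine (Module.End.finite_spectrum (Matrix.toLin' A)).subset ?_
  rintro μ ⟨f, hf, h⟩
  exact (Module.End.hasEigenvalue_of_hasEigenvector
    (Module.End.hasEigenvector_iff.2 ⟨Module.End.mem_eigenspace_iff.2 (by simpa using h),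
      hf⟩)).mem_spectrum

theorem le_specRad [Fintype V] (G : SimpleGraph V) {f : V → ℝ} {μ : ℝ} (hf : f ≠ 0)
    (h : adjMat G *ᵥ f = μ • f) : μ ≤ specRad G :=
  le_csSup (finite_eigenvalues _).bddAbove ⟨f, hf, h⟩

theorem exists_specRad_eigenvector [Fintype V] [Nonempty V] (G : SimpleGraph V) :
    ∃ f : V → ℝ, f ≠ 0 ∧ adjMat G *ᵥ f = specRad G • f := by
  classical
  have hA := adjMat_isHermitian G
  refine Set.Nonempty.csSup_mem ?_ (finite_eigenvalues (adjMat G))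
  obtain ⟨v⟩ := ‹Nonempty V›
  refine ⟨hA.eigenvalues v, (hA.eigenvectorBasis v).ofLp, ?_, hA.mulVec_eigenvectorBasis v⟩
  intro h
  exact hA.eigenvectorBasis.orthonormal.ne_zero v (by ext i; exact congrFun h i)

theorem posSemidef_specRad_sub [Fintype V] [DecidableEq V] (G : SimpleGraph V) :
    (specRad G • (1 : Matrix V V ℝ) - adjMat G).PosSemidef := by
  have hM : (specRad G • (1 : Matrix V V ℝ) - adjMat G).IsHermitian := by
    refine IsHermitian.sub ?_ (adjMat_isHermitian G)
    ext u v
    simp [Matrix.one_apply, eq_comm]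
  rw [hM.posSemidef_iff_eigenvalues_nonneg]
  intro v
  have h := hM.mulVec_eigenvectorBasis v
  have h0 : (hM.eigenvectorBasis v).ofLp ≠ 0 := fun h =>
    hM.eigenvectorBasis.orthonormal.ne_zero v (by ext i; exact congrFun h i)
  have := le_specRad G (μ := specRad G - hM.eigenvalues v) h0 (by
    rw [sub_mulVec, smul_mulVec, one_mulVec] at h
    rw [sub_smul, ← h, sub_sub_cancel])
  simpa using this

theorem dotProduct_specRad_sub [Fintype V] [DecidableEq V] (G : SimpleGraph V) (f : V → ℝ) :
    star f ⬝ᵥ ((specRad G • (1 : Matrix V V ℝ) - adjMat G) *ᵥ f)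
      = specRad G * (f ⬝ᵥ f) - f ⬝ᵥ (adjMat G *ᵥ f) := by
  simp [sub_mulVec, smul_mulVec, dotProduct_sub]

theorem quadForm_le_specRad [Fintype V] (G : SimpleGraph V) (f : V → ℝ) :
    f ⬝ᵥ (adjMat G *ᵥ f) ≤ specRad G * (f ⬝ᵥ f) := by
  classical
  have h := (posSemidef_specRad_sub G).dotProduct_mulVec_nonneg f
  rw [dotProduct_specRad_sub] at h
  linarith

theorem mulVec_eq_of_quadForm_eq [Fintype V] (G : SimpleGraph V) {f : V → ℝ}
    (h : f ⬝ᵥ (adjMat G *ᵥ f) = specRad G * (f ⬝ᵥ f)) :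
    adjMat G *ᵥ f = specRad G • f := by
  classical
  have h0 := ((posSemidef_specRad_sub G).dotProduct_mulVec_zero_iff f).1 (by
    rw [dotProduct_specRad_sub, h, sub_self])
  rw [sub_mulVec, smul_mulVec, one_mulVec, sub_eq_zero] at h0
  exact h0.symm

theorem exists_pos_eigenvector [Fintype V] [Nonempty V] {G : SimpleGraph V}
    (hG : G.Connected) :
    ∃ f : V → ℝ, (∀ v, 0 < f v) ∧ adjMat G *ᵥ f = specRad G • f := by
  classical
  obtain ⟨g, hg0, hg⟩ := exists_specRad_eigenvector G
  have hf : adjMat G *ᵥ (fun v => |g v|) = specRad G • (fun v => |g v|) := by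
    refine mulVec_eq_of_quadForm_eq G (le_antisymm (quadForm_le_specRad G _) ?_)
    have h1 : (fun v => |g v|) ⬝ᵥ (fun v => |g v|) = g ⬝ᵥ g := by
      simp [dotProduct]
    rw [h1]
    have h2 : specRad G * (g ⬝ᵥ g) = g ⬝ᵥ (adjMat G *ᵥ g) := by
      rw [hg]; simp
    rw [h2]
    simp only [dotProduct, mulVec, Finset.mul_sum]
    refine Finset.sum_le_sum fun u _ => Finset.sum_le_sum fun v _ => ?_
    refine (le_abs_self _).trans ?_
    rw [abs_mul, abs_mul, abs_of_nonneg (adjMat_nonneg G u v)]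
  refine ⟨fun v => |g v|, fun v => ?_, hf⟩
  by_contra hv
  have hv' : g v = 0 := by simpa using hv
  have step : ∀ u w, G.Adj u w → g u = 0 → g w = 0 := by
    intro u w huw hu
    have h := congrFun hf u
    simp only [mulVec, dotProduct, Pi.smul_apply, hu, abs_zero, smul_zero] at h
    rw [Finset.sum_eq_zero_iff_of_nonneg
      (fun x _ => mul_nonneg (adjMat_nonneg G u x) (abs_nonneg _))] at h
    simpa [adjMat_apply, huw] using h w (Finset.mem_univ w)
  refine hg0 (funext fun w => ?_)
  obtain ⟨p⟩ := hG.preconnected v w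
  clear hv
  induction p with
  | nil => exact hv'
  | cons h _ ih => exact ih (step _ _ h hv')

theorem adjMat_iso [Fintype V] [Fintype W] {G : SimpleGraph V} {H : SimpleGraph W} (e : G ≃g H)
    (u v : V) : adjMat H (e u) (e v) = adjMat G u v := by
  classical
  simp [adjMat_apply, e.map_adj_iff]

theorem mulVec_comp_iso [Fintype V] [Fintype W] {G : SimpleGraph V} {H : SimpleGraph W}
    (e : G ≃g H) (f : W → ℝ) (v : V) : (adjMat G *ᵥ (f ∘ e)) v = (adjMat H *ᵥ f) (e v) := by
  simp only [mulVec, dotProduct]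
  rw [← e.toEquiv.sum_comp]
  refine Finset.sum_congr rfl fun x _ => ?_
  simp [← adjMat_iso e]

theorem specRad_le_of_iso [Fintype V] [Fintype W] [Nonempty V] {G : SimpleGraph V}
    {H : SimpleGraph W} (e : G ≃g H) : specRad G ≤ specRad H := by
  obtain ⟨f, hf0, hf⟩ := exists_specRad_eigenvector G
  refine le_specRad H (f := f ∘ e.symm) (fun h => hf0 (funext fun v => ?_)) (funext fun w => ?_)
  · simpa using congrFun h (e v)
  · rw [mulVec_comp_iso e.symm f w, hf]
    simp

theorem specRad_eq_of_iso [Fintype V] [Fintype W] [Nonempty V] [Nonempty W] {G : SimpleGraph V}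
    {H : SimpleGraph W} (e : G ≃g H) : specRad G = specRad H :=
  le_antisymm (specRad_le_of_iso e) (specRad_le_of_iso e.symm)

end Spectral

section Tree

theorem deg_eq_sum [Fintype V] (G : SimpleGraph V) (v : V) :
    (deg G v : ℝ) = ∑ u, adjMat G v u := by
  classical
  simp only [adjMat_apply]
  rw [Finset.sum_boole]
  unfold deg
  rw [← SimpleGraph.card_neighborFinset_eq_degree]
  congr 2
  ext u
  simp

theorem deg_iso [Fintype V] [Fintype W] {G : SimpleGraph V} {H : SimpleGraph W} (e : G ≃g H)
    (v : V) : deg H (e v) = deg G v := by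
  have h : (deg H (e v) : ℝ) = deg G v := by
    rw [deg_eq_sum, deg_eq_sum, ← e.toEquiv.sum_comp]
    exact Finset.sum_congr rfl fun u _ => adjMat_iso e v u
  exact_mod_cast h

theorem card_leaves_iso [Fintype V] [Fintype W] {G : SimpleGraph V} {H : SimpleGraph W}
    (e : G ≃g H) :
    (univ.filter fun v => deg G v = 1).card = (univ.filter fun v => deg H v = 1).card := by
  refine Finset.card_bij (fun v _ => e v) ?_ (fun _ _ _ _ h => e.injective h) ?_
  · simp [deg_iso]
  · intro w hw
    exact ⟨e.symm w, by simpa [deg_iso] using hw, by simp⟩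

theorem sum_deg [Fintype V] {G : SimpleGraph V} (hG : G.IsTree) :
    ∑ v, deg G v + 2 = 2 * Fintype.card V := by
  classical
  have h1 : ∑ v, deg G v = 2 * #G.edgeFinset := by
    rw [← SimpleGraph.sum_degrees_eq_twice_card_edges]
    refine Finset.sum_congr rfl fun v _ => ?_
    unfold deg
    congr
  have h2 := hG.card_edgeFinset
  omega

theorem deg_pos [Fintype V] {G : SimpleGraph V} (hG : G.Connected) (h : 1 < Fintype.card V)
    (v : V) : 0 < deg G v := by
  classical
  have : Nontrivial V := Fintype.one_lt_card_iff_nontrivial.1 h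
  unfold deg
  exact hG.preconnected.degree_pos_of_nontrivial v

theorem sum_deg_le [Fintype V] {G : SimpleGraph V} (hG : G.IsTree) {k : ℕ}
    (h : 1 < Fintype.card V) (hk : (univ.filter fun v => deg G v = 1).card = k) (X : Finset V) :
    ∑ v ∈ X, deg G v + 2 ≤ 2 * #X + k := by
  classical
  have h1 := sum_deg hG
  rw [← Finset.sum_add_sum_compl X] at h1
  have h2 : ∑ v ∈ Xᶜ, 2 ≤ ∑ v ∈ Xᶜ, (deg G v + if deg G v = 1 then 1 else 0) := by
    refine Finset.sum_le_sum fun v _ => ?_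
    have := deg_pos hG.connected h v
    split_ifs <;> omega
  have h3 : ∑ v ∈ Xᶜ, (if deg G v = 1 then 1 else 0) ≤ k := by
    rw [← hk, Finset.card_filter]
    exact Finset.sum_le_sum_of_subset (Finset.subset_univ _)
  rw [Finset.sum_add_distrib] at h2
  simp only [Finset.sum_const, smul_eq_mul] at h2
  have h4 := Finset.card_add_card_compl X
  omega

theorem exists_parent {G : SimpleGraph V} (hG : G.Connected) (r : V) :
    ∃ p : V → V, ∀ v, v ≠ r → G.Adj v (p v) ∧ G.dist r (p v) + 1 = G.dist r v := by
  have : ∀ v, ∃ u, v ≠ r → G.Adj v u ∧ G.dist r u + 1 = G.dist r v := by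
    intro v
    obtain ⟨w, hw⟩ := hG.exists_walk_length_eq_dist v r
    cases w with
    | nil => exact ⟨r, fun h => absurd rfl h⟩
    | @cons _ u _ huv q =>
      refine ⟨u, fun _ => ⟨huv, ?_⟩⟩
      rw [SimpleGraph.Walk.length_cons] at hw
      have h1 := SimpleGraph.dist_le q
      have h2 := huv.diff_dist_adj (u := r)
      rw [SimpleGraph.dist_comm] at h1 hw
      omega
  exact Classical.axiom_of_choice this

theorem adj_iff_parent [Fintype V] {G : SimpleGraph V} (hG : G.IsTree) {r : V} {p : V → V}
    {h : V → ℕ} (hp : ∀ v, v ≠ r → G.Adj v (p v) ∧ h (p v) < h v) (u v : V) :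
    G.Adj u v ↔ (u ≠ r ∧ p u = v) ∨ (v ≠ r ∧ p v = u) := by
  classical
  constructor
  · intro huv
    have hsub : (univ.erase r).image (fun v => s(v, p v)) ⊆ G.edgeFinset := by
      intro e he
      obtain ⟨w, hw, rfl⟩ := Finset.mem_image.1 he
      simpa using (hp w (Finset.ne_of_mem_erase hw)).1
    have hinj : Set.InjOn (fun v => s(v, p v)) (univ.erase r : Finset V) := by
      intro x hx y hy hxy
      have hx := (hp x (by simpa using hx)).2
      have hy := (hp y (by simpa using hy)).2
      rcases Sym2.eq_iff.1 hxy with h1 | ⟨h1, h2⟩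
      · exact h1.1
      · rw [← h1] at hy
        rw [h2] at hx
        omega
    have heq := Finset.eq_of_subset_of_card_le hsub (by
      rw [Finset.card_image_of_injOn hinj, Finset.card_erase_of_mem (Finset.mem_univ r),
        Finset.card_univ]
      have := hG.card_edgeFinset
      omega)
    have hmem : s(u, v) ∈ G.edgeFinset := by simpa using huv
    rw [← heq] at hmem
    obtain ⟨w, hw, hwe⟩ := Finset.mem_image.1 hmem
    have hw := Finset.ne_of_mem_erase hw
    rcases Sym2.eq_iff.1 hwe with ⟨rfl, h2⟩ | ⟨rfl, h2⟩
    · exact Or.inl ⟨hw, h2⟩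
    · exact Or.inr ⟨hw, h2⟩
  · rintro (⟨h1, rfl⟩ | ⟨h1, rfl⟩)
    · exact (hp u h1).1
    · exact (hp v h1).1.symm

theorem sum_adjMat_le [Fintype V] {G : SimpleGraph V} (hG : G.IsTree) {X Y : Finset V} {r : V}
    (hX : r ∈ X) (hY : r ∈ Y) :
    ∑ x ∈ X, ∑ y ∈ Y, adjMat G x y + 2 ≤ #X + #Y := by
  classical
  obtain ⟨p, hp⟩ := exists_parent hG.connected r
  have hadj := adj_iff_parent hG (h := G.dist r) (p := p) (r := r)
    fun v hv => ⟨(hp v hv).1, by have := (hp v hv).2; omega⟩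
  have hle : ∀ x y, adjMat G x y ≤
      (if x ≠ r ∧ p x = y then 1 else 0) + (if y ≠ r ∧ p y = x then 1 else 0) := by
    intro x y
    rw [adjMat_apply]
    have := hadj x y
    split_ifs <;> first | tauto | norm_num
  have key : ∀ S T : Finset V, r ∈ S →
      ∑ x ∈ S, ∑ y ∈ T, (if x ≠ r ∧ p x = y then (1 : ℝ) else 0) + 1 ≤ #S := by
    intro S T hS
    have h1 : ∀ x ∈ S, ∑ y ∈ T, (if x ≠ r ∧ p x = y then (1 : ℝ) else 0)
        ≤ if x ≠ r then 1 else 0 := by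
      intro x _
      by_cases hx : x = r
      · simp [hx]
      · simp only [ne_eq, hx, not_false_eq_true, true_and, if_true]
        rw [Finset.sum_ite_eq]
        split_ifs <;> norm_num
    have h2 := Finset.sum_le_sum h1
    have h3 : ∑ x ∈ S, (if x ≠ r then (1 : ℝ) else 0) + 1 = #S := by
      rw [Finset.sum_boole, Finset.filter_ne', ← Finset.card_erase_add_one hS]
      push_cast
      rfl
    linarith
  have h := Finset.sum_le_sum (s := X) fun x _ => Finset.sum_le_sum (s := Y) fun y _ => hle x y
  simp only [Finset.sum_add_distrib] at h
  rw [Finset.sum_comm (s := X) (t := Y) (f := fun x y => if y ≠ r ∧ p y = x then (1 : ℝ) else 0)]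
    at h
  linarith [key X Y hX, key Y X hY]

end Tree

section Spider

/-- The spider with `k` legs of almost equal length on `Fin n`, listed in breadth-first order from
its center `0`: the parent of `j ≠ 0` is `j - k` (truncated subtraction). -/
def spider (n k : ℕ) : SimpleGraph (Fin n) where
  Adj i j := i ≠ j ∧ (i.val - k = j.val ∨ j.val - k = i.val)
  symm := ⟨fun _ _ h => ⟨h.1.symm, h.2.symm⟩⟩
  loopless := ⟨fun _ h => h.1 rfl⟩

theorem spider_adj {n k : ℕ} (hk : 1 ≤ k) (i j : Fin n) :
    (spider n k).Adj i j ↔ (0 < i.val ∧ i.val - k = j.val) ∨ (0 < j.val ∧ j.val - k = i.val) := by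
  simp only [spider, ne_eq, Fin.ext_iff]
  omega

theorem adjMat_spider {n k : ℕ} (hk : 1 ≤ k) (i j : Fin n) :
    adjMat (spider n k) i j = (if 0 < i.val ∧ i.val - k = j.val then 1 else 0)
      + (if 0 < j.val ∧ j.val - k = i.val then 1 else 0) := by
  classical
  rw [adjMat_apply]
  have h1 := spider_adj hk i j
  have h2 : ¬ ((0 < i.val ∧ i.val - k = j.val) ∧ (0 < j.val ∧ j.val - k = i.val)) := by omega
  split_ifs <;> first | tauto | norm_num

theorem sum_adjMat_spider {n k : ℕ} (hk : 1 ≤ k) (hkn : k < n) {F : ℕ → ℝ}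
    (hF : ∀ m, n ≤ m → F m = 0) (i : Fin n) :
    ∑ j, adjMat (spider n k) i j * F j =
      if i.val = 0 then ∑ m ∈ Icc 1 k, F m else F (i.val - k) + F (i.val + k) := by
  have hi := i.isLt
  simp only [adjMat_spider hk, add_mul, ite_mul, one_mul, zero_mul, Finset.sum_add_distrib]
  rw [Fin.sum_univ_eq_sum_range (fun m => if 0 < i.val ∧ i.val - k = m then F m else 0),
    Fin.sum_univ_eq_sum_range (fun m => if 0 < m ∧ m - k = i.val then F m else 0)]
  split_ifs with h0
  · rw [Finset.sum_eq_zero (fun m _ => if_neg (by omega)), zero_add, ← Finset.sum_filter]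
    refine Finset.sum_congr ?_ fun _ _ => rfl
    ext m
    simp only [Finset.mem_filter, Finset.mem_range, Finset.mem_Icc]
    omega
  · congr 1
    · rw [Finset.sum_eq_single (i.val - k)]
      · rw [if_pos (by omega)]
      · intro m _ hm
        rw [if_neg (by omega)]
      · intro h
        exact absurd (Finset.mem_range.2 (by omega)) h
    · rw [Finset.sum_eq_single (i.val + k)]
      · rw [if_pos (by omega)]
      · intro m _ hm
        rw [if_neg (by omega)]
      · intro h
        rw [Finset.mem_range] at h
        rw [hF _ (by omega), ite_self]

theorem deg_spider {n k : ℕ} (hk : 1 ≤ k) (hkn : k < n) (i : Fin n) :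
    deg (spider n k) i = if i.val = 0 then k else if i.val + k < n then 2 else 1 := by
  have hi := i.isLt
  have h := sum_adjMat_spider hk hkn (F := fun m => if m < n then 1 else 0)
    (fun m hm => if_neg (by omega)) i
  simp only [Fin.is_lt, if_true, mul_one] at h
  rw [← deg_eq_sum] at h
  have h1 : ∑ m ∈ Icc 1 k, (if m < n then (1 : ℝ) else 0) = k := by
    rw [Finset.sum_congr rfl (g := fun _ => (1 : ℝ))
      (fun m hm => if_pos (by have := Finset.mem_Icc.1 hm; omega))]
    simp
  rw [h1, if_pos (show i.val - k < n by omega)] at h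
  have : (deg (spider n k) i : ℝ) =
      ((if i.val = 0 then k else if i.val + k < n then 2 else 1 : ℕ) : ℝ) := by
    rw [h]
    split_ifs <;> norm_num
  exact_mod_cast this

theorem spider_connected {n k : ℕ} (hk : 1 ≤ k) (hn : 0 < n) : (spider n k).Connected := by
  have h0 : ∀ m (hm : m < n), (spider n k).Reachable ⟨m, hm⟩ ⟨0, hn⟩ := by
    intro m
    induction m using Nat.strong_induction_on with
    | _ m ih =>
      intro hm
      rcases Nat.eq_zero_or_pos m with rfl | hpos
      · rfl
      · have hadj : (spider n k).Adj ⟨m, hm⟩ ⟨m - k, by omega⟩ :=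
          (spider_adj hk _ _).2 (Or.inl ⟨hpos, rfl⟩)
        exact hadj.reachable.trans (ih (m - k) (by omega) (by omega))
  have : Nonempty (Fin n) := ⟨⟨0, hn⟩⟩
  exact ⟨fun u v => (h0 u.val u.isLt).trans (h0 v.val v.isLt).symm⟩

theorem card_filter_val_lt {n a : ℕ} (ha : a ≤ n) :
    #(univ.filter fun i : Fin n => i.val < a) = a := by
  rw [Fin.card_filter_val_lt]
  omega

theorem card_leaves_spider {n k : ℕ} (hk : 2 ≤ k) (hkn : k < n) :
    #(univ.filter fun i => deg (spider n k) i = 1) = k := by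
  have h : (univ.filter fun i => deg (spider n k) i = 1)
      = (univ.filter fun i : Fin n => i.val < n - k)ᶜ := by
    ext i
    simp only [Finset.mem_filter, Finset.mem_univ, true_and, Finset.mem_compl,
      deg_spider (by omega : 1 ≤ k) hkn]
    split_ifs <;> omega
  rw [h, Finset.card_compl, card_filter_val_lt (by omega), Fintype.card_fin]
  omega

theorem sum_deg_spider {n k : ℕ} (hk : 1 ≤ k) (hkn : k < n) :
    ∑ i, deg (spider n k) i = 2 * (n - 1) := by
  simp only [deg_spider hk hkn]
  rw [Fin.sum_univ_eq_sum_range (fun m => if m = 0 then k else if m + k < n then 2 else 1)]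
  obtain ⟨d, rfl⟩ : ∃ d, n = d + 1 + k := ⟨n - k - 1, by omega⟩
  rw [show d + 1 + k = 1 + d + k by omega, Finset.sum_range_add, Finset.sum_range_add,
    Finset.sum_congr rfl (g := fun _ => 2) (s₁ := range d)
      (fun m hm => by have := Finset.mem_range.1 hm; rw [if_neg (by omega), if_pos (by omega)]),
    Finset.sum_congr rfl (g := fun _ => 1) (s₁ := range k)
      (fun m hm => by have := Finset.mem_range.1 hm; rw [if_neg (by omega), if_neg (by omega)])]
  simp
  omega

theorem spider_isTree {n k : ℕ} (hk : 1 ≤ k) (hkn : k < n) : (spider n k).IsTree := by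
  classical
  rw [SimpleGraph.isTree_iff_connected_and_card]
  refine ⟨spider_connected hk (by omega), ?_⟩
  have h1 := (spider n k).sum_degrees_eq_twice_card_edges
  have h2 := sum_deg_spider hk hkn
  have h3 : ∑ i, (spider n k).degree i = ∑ i, deg (spider n k) i := by
    refine Finset.sum_congr rfl fun v _ => ?_
    unfold deg
    congr
  rw [Nat.card_eq_fintype_card, Nat.card_eq_fintype_card, ← SimpleGraph.edgeFinset_card,
    Fintype.card_fin]
  omega

theorem sum_prefix_adjMat_spider {n k : ℕ} (hk : 1 ≤ k) (hkn : k < n) {a b : ℕ} (ha : 1 ≤ a)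
    (hab : a ≤ b) (hb : b ≤ n) :
    ((a - 1 + min (b - 1) (a + k - 1) : ℕ) : ℝ) ≤
      ∑ i : Fin n with i.val < a, ∑ j : Fin n with j.val < b, adjMat (spider n k) i j := by
  have hrow : ∀ i : Fin n, ∑ j : Fin n with j.val < b, adjMat (spider n k) i j =
      if i.val = 0 then ∑ m ∈ Icc 1 k, (if m < b then (1 : ℝ) else 0)
      else (if i.val - k < b then 1 else 0) + (if i.val + k < b then 1 else 0) := by
    intro i
    rw [← sum_adjMat_spider hk hkn (F := fun m => if m < b then 1 else 0)
      (fun m hm => if_neg (by omega)) i, Finset.sum_filter]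
    simp
  simp only [hrow]
  rw [Finset.sum_filter, Fin.sum_univ_eq_sum_range (fun m => if m < a then
    if m = 0 then ∑ m ∈ Icc 1 k, (if m < b then (1 : ℝ) else 0)
      else (if m - k < b then 1 else 0) + (if m + k < b then 1 else 0) else 0),
    ← Finset.sum_filter]
  have hfil : (range n).filter (fun m => m < a) = range a := by
    ext m
    simp only [Finset.mem_filter, Finset.mem_range]
    omega
  rw [hfil]
  clear hfil
  induction a, ha using Nat.le_induction with
  | base =>
    simp only [Finset.sum_range_one, if_true]
    rw [← Finset.sum_filter, Finset.sum_const, nsmul_one]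
    norm_cast
    have : (Icc 1 k).filter (fun m => m < b) = Icc 1 (min k (b - 1)) := by
      ext m
      simp only [Finset.mem_filter, Finset.mem_Icc]
      omega
    rw [this, Nat.card_Icc]
    omega
  | succ a ha ih =>
    rw [Finset.sum_range_succ, if_neg (by omega), if_pos (by omega)]
    have h := ih (by omega)
    have h2 : ((a + 1 - 1 + min (b - 1) (a + 1 + k - 1) : ℕ) : ℝ) ≤
        ((a - 1 + min (b - 1) (a + k - 1) : ℕ) : ℝ) + (1 + if a + k < b then 1 else 0) := by
      split_ifs <;> norm_cast <;> omega
    linarith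

end Spider

section Comparison

theorem sum_mul_nonneg_of_prefix_sum_nonneg {c F : ℕ → ℝ} (hF : Antitone F) (hF0 : ∀ m, 0 ≤ F m)
    (n : ℕ) (hc : ∀ a ≤ n, 0 ≤ ∑ i ∈ range a, c i) : 0 ≤ ∑ i ∈ range n, c i * F i := by
  have key : ∀ m, m + 1 ≤ n →
      (∑ i ∈ range (m + 1), c i) * F m ≤ ∑ i ∈ range (m + 1), c i * F i := by
    intro m
    induction m with
    | zero => simp
    | succ m ih =>
      intro hm
      rw [Finset.sum_range_succ, Finset.sum_range_succ _ (m + 1), add_mul]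
      have h1 := ih (by omega)
      have h2 := mul_le_mul_of_nonneg_left (hF (Nat.le_succ m)) (hc (m + 1) (by omega))
      simp only [Nat.succ_eq_add_one] at h2
      linarith
  cases n with
  | zero => simp
  | succ m => exact (mul_nonneg (hc _ le_rfl) (hF0 m)).trans (key m le_rfl)

theorem sum_fin_mul_nonneg {n : ℕ} {c : Fin n → ℝ} {F : ℕ → ℝ} (hF : Antitone F)
    (hF0 : ∀ m, 0 ≤ F m) (hc : ∀ a ≤ n, 0 ≤ ∑ i : Fin n with i.val < a, c i) :
    0 ≤ ∑ i : Fin n, c i * F i := by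
  have h := sum_mul_nonneg_of_prefix_sum_nonneg hF hF0
    (c := fun m => if h : m < n then c ⟨m, h⟩ else 0) n (fun a ha => by
      have : 0 ≤ ∑ i : Fin n, if i.val < a then
          (if h : i.val < n then c ⟨i.val, h⟩ else 0) else 0 := by
        simpa [Finset.sum_filter] using hc a ha
      rw [Fin.sum_univ_eq_sum_range (fun m => if m < a then
        (if h : m < n then c ⟨m, h⟩ else 0) else 0), ← Finset.sum_filter] at this
      convert this using 2
      ext m
      simp only [Finset.mem_filter, Finset.mem_range]
      omega)
  rw [← Fin.sum_univ_eq_sum_range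
    (fun m => (if h : m < n then c ⟨m, h⟩ else 0) * F m)] at h
  simpa using h

theorem sum_sum_mul_nonneg {n : ℕ} {M : Fin n → Fin n → ℝ} {F : ℕ → ℝ} (hF : Antitone F)
    (hF0 : ∀ m, 0 ≤ F m)
    (hM : ∀ a ≤ n, ∀ b ≤ n, 0 ≤ ∑ i : Fin n with i.val < a, ∑ j : Fin n with j.val < b, M i j) :
    0 ≤ ∑ i : Fin n, (∑ j : Fin n, M i j * F j) * F i := by
  refine sum_fin_mul_nonneg hF hF0 fun a ha => ?_
  rw [Finset.sum_comm]
  simp only [← Finset.sum_mul]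
  refine sum_fin_mul_nonneg hF hF0 fun b hb => ?_
  rw [Finset.sum_comm]
  exact hM a ha b hb

theorem sum_prefix_adjMat_le {n k : ℕ} (hk : 2 ≤ k) (hkn : k < n) {H : SimpleGraph (Fin n)}
    (hH : H.IsTree) (hl : #(univ.filter fun v => deg H v = 1) = k) {a b : ℕ}
    (hab : a ≤ b) (hb : b ≤ n) :
    ∑ i : Fin n with i.val < a, ∑ j : Fin n with j.val < b, adjMat H i j ≤
      ∑ i : Fin n with i.val < a, ∑ j : Fin n with j.val < b, adjMat (spider n k) i j := by
  rcases Nat.eq_zero_or_pos a with rfl | ha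
  · simp
  refine le_trans ?_ (sum_prefix_adjMat_spider (by omega) hkn ha hab hb)
  have h1 := sum_adjMat_le hH (X := univ.filter fun i : Fin n => i.val < a)
    (Y := univ.filter fun i : Fin n => i.val < b) (r := ⟨0, by omega⟩) (by simpa using ha)
    (by simp only [Finset.mem_filter, Finset.mem_univ, true_and]; omega)
  have h2 := sum_deg_le hH (by simp only [Fintype.card_fin]; omega) hl
    (univ.filter fun i : Fin n => i.val < a)
  rw [card_filter_val_lt (by omega), card_filter_val_lt hb] at h1
  rw [card_filter_val_lt (by omega)] at h2
  have h3 : ∑ i : Fin n with i.val < a, ∑ j : Fin n with j.val < b, adjMat H i j ≤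
      ∑ i : Fin n with i.val < a, (deg H i : ℝ) := by
    refine Finset.sum_le_sum fun i _ => ?_
    rw [deg_eq_sum]
    exact Finset.sum_le_sum_of_subset_of_nonneg (Finset.subset_univ _)
      fun j _ _ => adjMat_nonneg H i j
  have h4 : ∑ i : Fin n with i.val < a, (deg H i : ℝ) + 2 ≤ 2 * a + k := by exact_mod_cast h2
  rcases min_choice (b - 1) (a + k - 1) with h | h <;> rw [h]
  · have : ((a - 1 + (b - 1) : ℕ) : ℝ) + 2 = a + b := by norm_cast; omega
    linarith
  · have : ((a - 1 + (a + k - 1) : ℕ) : ℝ) + 2 = 2 * a + k := by norm_cast; omega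
    linarith

theorem quadForm_le_spider {n k : ℕ} (hk : 2 ≤ k) (hkn : k < n) {H : SimpleGraph (Fin n)}
    (hH : H.IsTree) (hl : #(univ.filter fun v => deg H v = 1) = k) {F : ℕ → ℝ}
    (hF : Antitone F) (hF0 : ∀ m, 0 ≤ F m) :
    (fun i : Fin n => F i) ⬝ᵥ (adjMat H *ᵥ fun i => F i) ≤
      (fun i : Fin n => F i) ⬝ᵥ (adjMat (spider n k) *ᵥ fun i => F i) := by
  have h := sum_sum_mul_nonneg (M := fun i j => adjMat (spider n k) i j - adjMat H i j) hF hF0 (by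
    intro a ha b hb
    simp only [Finset.sum_sub_distrib, sub_nonneg]
    rcases le_total a b with hab | hab
    · exact sum_prefix_adjMat_le hk hkn hH hl hab hb
    · have hswap : ∀ G : SimpleGraph (Fin n),
          ∑ i : Fin n with i.val < a, ∑ j : Fin n with j.val < b, adjMat G i j =
          ∑ i : Fin n with i.val < b, ∑ j : Fin n with j.val < a, adjMat G i j := fun G =>
        Finset.sum_comm.trans (Finset.sum_congr rfl fun _ _ => Finset.sum_congr rfl fun _ _ =>
          adjMat_comm G _ _)
      rw [hswap, hswap]
      exact sum_prefix_adjMat_le hk hkn hH hl hab ha)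
  simp only [sub_mul, Finset.sum_sub_distrib, sub_nonneg] at h
  simp only [dotProduct, mulVec]
  simpa only [mul_comm (F _)] using h

end Comparison

section Equality

theorem sum_adjMat_mul [Fintype V] (G : SimpleGraph V) [DecidableRel G.Adj] (f : V → ℝ) (v : V) :
    ∑ u, adjMat G v u * f u = ∑ u with G.Adj v u, f u := by
  simp [adjMat_apply, Finset.sum_filter]

theorem deg_eq_card [Fintype V] (G : SimpleGraph V) [DecidableRel G.Adj] (v : V) :
    deg G v = #(univ.filter fun u => G.Adj v u) := by
  have h : (deg G v : ℝ) = #(univ.filter fun u => G.Adj v u) := by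
    rw [deg_eq_sum]
    simpa using sum_adjMat_mul G (fun _ => 1) v
  exact_mod_cast h

/-- A set of at most `k` positive indices whose `F`-values have the same sum as those of
`1, …, k` can be enumerated so that the `F`-values agree. -/
theorem exists_enumeration_of_sum_eq {n k : ℕ} (hkn : k < n) {F : ℕ → ℝ} (hF : Antitone F)
    (hpos : ∀ m < n, 0 < F m) {N : Finset (Fin n)} (hN : ∀ i ∈ N, 0 < i.val) (hcard : #N ≤ k)
    (hsum : ∑ i ∈ N, F i = ∑ m ∈ Icc 1 k, F m) :
    #N = k ∧ ∃ c : ℕ → Fin n, (∀ j ∈ Icc 1 k, c j ∈ N ∧ F (c j) = F j) ∧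
      Set.InjOn c (Icc 1 k : Finset ℕ) := by
  set ε := N.orderEmbOfFin rfl with hε
  have hge : ∀ m (hm : m < #N), m + 1 ≤ (ε ⟨m, hm⟩).val := by
    intro m
    induction m with
    | zero => exact fun hm => hN _ (N.orderEmbOfFin_mem rfl _)
    | succ m ih =>
      intro hm
      have h1 := ih (by omega)
      have h2 : ε ⟨m, by omega⟩ < ε ⟨m + 1, hm⟩ := ε.strictMono (by simp)
      have h3 : (ε ⟨m, by omega⟩).val < (ε ⟨m + 1, hm⟩).val := h2
      omega
  have hsumε : ∑ i ∈ N, F i = ∑ i : Fin #N, F (ε i) := by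
    rw [← Finset.sum_coe_sort N, ← (N.orderIsoOfFin rfl).toEquiv.sum_comp]
    rfl
  have hle : ∀ i : Fin #N, F (ε i) ≤ F (i.val + 1) := fun i => hF (hge i.val i.isLt)
  have hIcc : ∀ d, ∑ m ∈ Icc 1 d, F m = ∑ i ∈ range d, F (i + 1) := by
    intro d
    rw [Finset.range_eq_Ico, Finset.sum_Ico_add' F 0 d 1]
    rfl
  have hle' := Finset.sum_le_sum fun i (_ : i ∈ (univ : Finset (Fin #N))) => hle i
  rw [← hsumε, hsum, Fin.sum_univ_eq_sum_range (fun i => F (i + 1)), hIcc] at hle'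
  have hNk : #N = k := by
    by_contra hne
    have h1 := Finset.sum_lt_sum_of_subset (f := fun i => F (i + 1)) (i := #N)
      (Finset.range_subset_range.2 hcard) (Finset.mem_range.2 (by omega)) Finset.notMem_range_self
      (hpos (#N + 1) (by omega))
      (fun j hj _ => (hpos (j + 1) (by rw [Finset.mem_range] at hj; omega)).le)
    linarith
  refine ⟨hNk, ?_⟩
  have heq : ∀ i : Fin #N, F (ε i) = F (i.val + 1) := by
    have : ∑ i : Fin #N, F (ε i) = ∑ i : Fin #N, F (i.val + 1) := by
      rw [← hsumε, hsum, Fin.sum_univ_eq_sum_range (fun i => F (i + 1)), hIcc, hNk]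
    have h := (Finset.sum_eq_sum_iff_of_le fun i _ => hle i).1 this
    exact fun i => h i (Finset.mem_univ i)
  refine ⟨fun j => if h : j - 1 < #N then ε ⟨j - 1, h⟩ else ⟨0, by omega⟩, ?_, ?_⟩
  · intro j hj
    rw [Finset.mem_Icc] at hj
    have h : j - 1 < #N := by omega
    simp only [h, dif_pos]
    refine ⟨N.orderEmbOfFin_mem rfl _, ?_⟩
    rw [heq]
    congr 1
    simp only
    omega
  · intro i hi j hj hij
    rw [Finset.mem_coe, Finset.mem_Icc] at hi hj
    have h1 : i - 1 < #N := by omega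
    have h2 : j - 1 < #N := by omega
    simp only [h1, h2, dif_pos] at hij
    have := Fin.ext_iff.1 (ε.injective hij)
    simp only at this
    omega

/-- The vertices of a spider with center `r`, first vertices of the legs `c 1, …, c k` and
successor function `s` along the legs, in breadth-first order. -/
noncomputable def legWalk {α : Type*} (r : α) (c : ℕ → α) (s : α → α) (k : ℕ) : ℕ → α
  | 0 => r
  | j + 1 => if h : j + 1 ≤ k ∨ k = 0 then c (j + 1) else s (legWalk r c s k (j + 1 - k))

theorem legWalk_of_le {α : Type*} {r : α} {c : ℕ → α} {s : α → α} {k j : ℕ} (h1 : 1 ≤ j)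
    (h2 : j ≤ k) : legWalk r c s k j = c j := by
  obtain ⟨j, rfl⟩ : ∃ i, j = i + 1 := ⟨j - 1, by omega⟩
  rw [legWalk, dif_pos (Or.inl h2)]

theorem legWalk_of_lt {α : Type*} {r : α} {c : ℕ → α} {s : α → α} {k j : ℕ} (h1 : 1 ≤ k)
    (h2 : k < j) : legWalk r c s k j = s (legWalk r c s k (j - k)) := by
  obtain ⟨j, rfl⟩ : ∃ i, j = i + 1 := ⟨j - 1, by omega⟩
  rw [legWalk, dif_neg (by omega)]

theorem nonempty_iso_of_parent [Fintype V] {n k : ℕ} (hk : 1 ≤ k) (hn : Fintype.card V = n)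
    {G : SimpleGraph V} {r : V} {p : V → V}
    (hadj : ∀ u v, G.Adj u v ↔ (u ≠ r ∧ p u = v) ∨ (v ≠ r ∧ p v = u)) {w : ℕ → V}
    (hw0 : w 0 = r) (hw : ∀ j < n, 0 < j → w j ≠ r ∧ p (w j) = w (j - k))
    (hinj : Set.InjOn w (Icc 1 k : Finset ℕ)) : Nonempty (spider n k ≃g G) := by
  have hne : ∀ j < n, ∀ i < j, w i ≠ w j := by
    intro j
    induction j using Nat.strong_induction_on with
    | _ j ih =>
      intro hj i hij h
      obtain ⟨h1, h2⟩ := hw j hj (by omega)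
      rcases Nat.eq_zero_or_pos i with rfl | hi
      · exact h1 (by rw [← h, hw0])
      · obtain ⟨_, h3⟩ := hw i (by omega) hi
        by_cases hjk : j ≤ k
        · have := hinj (by simp; omega) (by simp; omega) h
          omega
        · refine ih (j - k) (by omega) (by omega) (i - k) (by omega) ?_
          rw [← h2, ← h3, h]
  have hwinj : ∀ i j : Fin n, w i = w j ↔ i.val = j.val := by
    intro i j
    refine ⟨fun h => ?_, fun h => by rw [h]⟩
    rcases lt_trichotomy i.val j.val with hlt | heq | hlt
    · exact absurd h (hne _ j.isLt _ hlt)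
    · exact heq
    · exact absurd h.symm (hne _ i.isLt _ hlt)
  have hbij : Function.Bijective (fun i : Fin n => w i) := by
    rw [Fintype.bijective_iff_injective_and_card]
    exact ⟨fun i j h => Fin.ext ((hwinj i j).1 h), by simp [hn]⟩
  have hpar : ∀ i j : Fin n, (w i ≠ r ∧ p (w i) = w j) ↔ (0 < i.val ∧ i.val - k = j.val) := by
    intro i j
    rcases Nat.eq_zero_or_pos i.val with hi | hi
    · simp [hi, hw0]
    · obtain ⟨h1, h2⟩ := hw i i.isLt hi
      rw [h2]
      have := hwinj ⟨i.val - k, by omega⟩ j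
      simp only at this
      rw [this]
      tauto
  refine ⟨⟨Equiv.ofBijective _ hbij, ?_⟩⟩
  intro i j
  simp only [Equiv.ofBijective_apply]
  rw [hadj, spider_adj hk, hpar, hpar]

theorem nonempty_iso_of_common_eigenvector {n k : ℕ} (hk : 2 ≤ k) (hkn : k < n)
    {H : SimpleGraph (Fin n)} (hH : H.IsTree) (hl : #(univ.filter fun v => deg H v = 1) = k)
    {F : ℕ → ℝ} (hF : Antitone F) (hpos : ∀ m < n, 0 < F m) (hF0 : ∀ m, n ≤ m → F m = 0) {μ : ℝ}
    (h₁ : adjMat H *ᵥ (fun i : Fin n => F i) = μ • fun i : Fin n => F i)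
    (h₂ : adjMat (spider n k) *ᵥ (fun i : Fin n => F i) = μ • fun i : Fin n => F i) :
    Nonempty (spider n k ≃g H) := by
  classical
  have hcard : 1 < Fintype.card (Fin n) := by rw [Fintype.card_fin]; omega
  have hrow₁ : ∀ i : Fin n, ∑ j with H.Adj i j, F j = μ * F i := fun i => by
    rw [← sum_adjMat_mul H (fun j : Fin n => F j)]
    exact congrFun h₁ i
  have hrow₂ : ∀ i : Fin n,
      (if i.val = 0 then ∑ m ∈ Icc 1 k, F m else F (i.val - k) + F (i.val + k)) = μ * F i :=
    fun i => by
      rw [← sum_adjMat_spider (by omega) hkn hF0]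
      exact congrFun h₂ i
  set r : Fin n := ⟨0, by omega⟩ with hr
  obtain ⟨p, hp⟩ := exists_parent hH.connected r
  have hadj := adj_iff_parent hH (h := H.dist r) (p := p) (r := r)
    fun v hv => ⟨(hp v hv).1, by have := (hp v hv).2; omega⟩
  have hdeg : ∀ v, #(univ.filter fun u => H.Adj v u) = deg H v := fun v => (deg_eq_card H v).symm
  have hroot := sum_deg_le hH hcard hl {r}
  simp only [Finset.sum_singleton, Finset.card_singleton] at hroot
  obtain ⟨hN, c, hc, hcinj⟩ := exists_enumeration_of_sum_eq hkn hF hpos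
    (N := univ.filter fun u => H.Adj r u) (fun i hi => by
      have h := (Finset.mem_filter.1 hi).2.ne
      rw [Ne, Fin.ext_iff] at h
      simp only [hr] at h
      omega)
    (by rw [hdeg]; omega)
    (by rw [hrow₁, ← hrow₂, if_pos rfl])
  have hdeg2 : ∀ v, v ≠ r → deg H v ≤ 2 := by
    intro v hv
    have h := sum_deg_le hH hcard hl {r, v}
    rw [Finset.sum_pair hv.symm, Finset.card_pair hv.symm, ← hdeg r, hN] at h
    omega
  set s : Fin n → Fin n := fun v => if h : ∃ x, x ≠ r ∧ p x = v then h.choose else v with hs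
  have hsp : ∀ v x, x ≠ r → p x = v → s v ≠ r ∧ p (s v) = v := by
    intro v x hx hxv
    have h : ∃ x, x ≠ r ∧ p x = v := ⟨x, hx, hxv⟩
    simp only [hs, h, dif_pos]
    exact h.choose_spec
  have hw : ∀ j < n, F (legWalk r c s k j).val = F j ∧ (0 < j → legWalk r c s k j ≠ r ∧
      p (legWalk r c s k j) = legWalk r c s k (j - k)) := by
    intro j
    induction j using Nat.strong_induction_on with
    | _ j ih =>
      intro hj
      rcases Nat.eq_zero_or_pos j with rfl | hj0
      · simp [legWalk, hr]
      by_cases hjk : j ≤ k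
      · rw [legWalk_of_le hj0 hjk, show j - k = 0 by omega, legWalk]
        obtain ⟨h1, h2⟩ := hc j (Finset.mem_Icc.2 ⟨hj0, hjk⟩)
        refine ⟨h2, fun _ => ?_⟩
        have h3 := (hadj _ _).1 (Finset.mem_filter.1 h1).2
        tauto
      · obtain ⟨hm, hm'⟩ := ih (j - k) (by omega) (by omega)
        obtain ⟨hmr, hmp⟩ := hm' (by omega)
        have hmm := (ih (j - k - k) (by omega) (by omega)).1
        rw [legWalk_of_lt (by omega) (by omega)]
        set v := legWalk r c s k (j - k) with hv
        have hrow := hrow₂ ⟨j - k, by omega⟩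
        rw [if_neg (by simp only; omega)] at hrow
        simp only at hrow
        rw [← hm, ← hrow₁ v, show j - k + k = j by omega, ← hmm, ← hmp] at hrow
        have hmem : p v ∈ univ.filter fun u => H.Adj v u := by simpa using (hp v hmr).1
        rw [← Finset.add_sum_erase _ _ hmem] at hrow
        have hrow := add_left_cancel hrow
        have hcardle : #((univ.filter fun u => H.Adj v u).erase (p v)) ≤ 1 := by
          rw [Finset.card_erase_of_mem hmem, hdeg]
          have := hdeg2 v hmr
          omega
        obtain ⟨x, hx⟩ : ((univ.filter fun u => H.Adj v u).erase (p v)).Nonempty := by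
          rw [Finset.nonempty_iff_ne_empty]
          intro h
          rw [h, Finset.sum_empty] at hrow
          have := hpos j hj
          linarith
        have hxr : x ≠ r ∧ p x = v := by
          have h1 := Finset.mem_erase.1 hx
          have h2 := (hadj v x).1 (Finset.mem_filter.1 h1.2).2
          have h3 := h1.1.symm
          tauto
        obtain ⟨hsr, hsv⟩ := hsp v x hxr.1 hxr.2
        have hsmem : s v ∈ (univ.filter fun u => H.Adj v u).erase (p v) := by
          refine Finset.mem_erase.2 ⟨fun h => ?_, by simpa [hadj] using Or.inr ⟨hsr, hsv⟩⟩
          have h1 := (hp _ hsr).2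
          have h2 := (hp _ hmr).2
          rw [hsv, h] at h1
          omega
        refine ⟨?_, fun _ => ⟨hsr, hsv⟩⟩
        rw [hrow]
        have : (univ.filter fun u => H.Adj v u).erase (p v) = {s v} :=
          (Finset.eq_singleton_iff_unique_mem.2
            ⟨hsmem, fun y hy => Finset.card_le_one.1 hcardle y hy _ hsmem⟩)
        rw [this, Finset.sum_singleton]
  refine nonempty_iso_of_parent (by omega) (Fintype.card_fin n) hadj (w := legWalk r c s k)
    (by rw [legWalk]) (fun j hj => (hw j hj).2) ?_
  intro i hi j hj hij
  have hi' := Finset.mem_Icc.1 (Finset.mem_coe.1 hi)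
  have hj' := Finset.mem_Icc.1 (Finset.mem_coe.1 hj)
  rw [legWalk_of_le hi'.1 hi'.2, legWalk_of_le hj'.1 hj'.2] at hij
  exact hcinj hi hj hij

end Equality

section Extremal

theorem specRad_le_spider [Fintype V] [Nonempty V] {k : ℕ} (hk : 2 ≤ k) (hkn : k < Fintype.card V)
    {H : SimpleGraph V} (hH : H.IsTree) (hl : #(univ.filter fun v => deg H v = 1) = k) :
    specRad H ≤ specRad (spider (Fintype.card V) k) ∧
      (specRad H = specRad (spider (Fintype.card V) k) →
        Nonempty (spider (Fintype.card V) k ≃g H)) := by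
  obtain ⟨g, hg, hgH⟩ := exists_pos_eigenvector hH.connected
  set n := Fintype.card V with hn
  set e : Fin n ≃ V :=
    (Tuple.sort fun i => -g ((Fintype.equivFin V).symm i)).trans (Fintype.equivFin V).symm with he
  have hmono : ∀ i j : Fin n, i ≤ j → g (e j) ≤ g (e i) := fun i j hij =>
    neg_le_neg_iff.1 (Tuple.monotone_sort (fun i => -g ((Fintype.equivFin V).symm i)) hij)
  set F : ℕ → ℝ := fun m => if h : m < n then g (e ⟨m, h⟩) else 0 with hFdef
  have hFv : (fun i : Fin n => F i) = g ∘ e := by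
    ext i
    simp [hFdef]
  have hpos : ∀ m < n, 0 < F m := fun m hm => by simpa [hFdef, hm] using hg _
  have hzero : ∀ m, n ≤ m → F m = 0 := fun m hm => dif_neg (by omega)
  have hnonneg : ∀ m, 0 ≤ F m := fun m => by
    rcases lt_or_ge m n with h | h
    · exact (hpos m h).le
    · exact (hzero m h).ge
  have hF : Antitone F := by
    intro a b hab
    rcases lt_or_ge b n with h | h
    · simp only [hFdef, h, dif_pos, lt_of_le_of_lt hab h]
      exact hmono _ _ hab
    · rw [hzero b h]
      exact hnonneg a
  set iso : H.comap e ≃g H := SimpleGraph.Iso.comap e H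
  have hH' : (H.comap e).IsTree := iso.isTree_iff.2 hH
  have hl' : #(univ.filter fun v => deg (H.comap e) v = 1) = k := by rw [card_leaves_iso iso, hl]
  have h₁ : adjMat (H.comap e) *ᵥ (fun i : Fin n => F i) = specRad H • fun i : Fin n => F i := by
    rw [hFv]
    ext i
    exact (mulVec_comp_iso iso g i).trans (congrFun hgH (e i))
  have hle := quadForm_le_spider hk hkn hH' hl' hF hnonneg
  rw [h₁, dotProduct_smul, smul_eq_mul] at hle
  have hub := quadForm_le_specRad (spider n k) (fun i : Fin n => F i)
  have hff : 0 < (fun i : Fin n => F i) ⬝ᵥ (fun i : Fin n => F i) :=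
    Finset.sum_pos (fun i _ => mul_pos (hpos i i.isLt) (hpos i i.isLt))
      ⟨⟨0, Fintype.card_pos⟩, Finset.mem_univ _⟩
  refine ⟨le_of_mul_le_mul_right (hle.trans hub) hff, fun heq => ?_⟩
  rw [heq] at hle h₁
  have h₂ := mulVec_eq_of_quadForm_eq (spider n k) (le_antisymm hub hle)
  obtain ⟨φ⟩ := nonempty_iso_of_common_eigenvector hk hkn hH' hl' hF hpos hzero h₁ h₂
  exact ⟨φ.trans iso⟩

theorem dist_eq_of_height {G : SimpleGraph V} (hG : G.Connected) {r : V} {h : V → ℕ}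
    (hr : h r = 0) (hle : ∀ u v, G.Adj u v → h v ≤ h u + 1)
    (hpar : ∀ v, v ≠ r → ∃ u, G.Adj u v ∧ h u + 1 = h v) (v : V) : G.dist r v = h v := by
  apply le_antisymm
  · induction hm : h v generalizing v with
    | zero =>
      by_cases hv : v = r
      · simp [hv]
      · obtain ⟨u, _, hu⟩ := hpar v hv
        omega
    | succ m ih =>
      by_cases hv : v = r
      · simp [hv]
      · obtain ⟨u, huv, hu⟩ := hpar v hv
        have h1 := ih u (by omega)
        have h2 := huv.diff_dist_adj (u := r)
        omega
  · obtain ⟨w, hw⟩ := hG.exists_walk_length_eq_dist r v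
    rw [← hw]
    have : ∀ {a b : V} (q : G.Walk a b), h b ≤ h a + q.length := by
      intro a b q
      induction q with
      | nil => simp
      | cons hab q ih =>
        have := hle _ _ hab
        rw [SimpleGraph.Walk.length_cons]
        omega
    have := this w
    omega

theorem degMultiset_of_iso_spider [Fintype V] {G : SimpleGraph V} {n k : ℕ} (hk : 1 ≤ k)
    (hkn : k < n) (e : spider n k ≃g G) :
    degMultiset G = k ::ₘ (Multiset.replicate (n - k - 1) 2 + Multiset.replicate k 1) := by
  have h1 : degMultiset G = univ.val.map (deg (spider n k)) := by
    unfold degMultiset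
    rw [← Finset.map_univ_equiv e.toEquiv, Finset.map_val, Multiset.map_map]
    exact Multiset.map_congr rfl fun i _ => deg_iso e i
  have h2 : univ.val.map (deg (spider n k)) =
      (Multiset.range n).map fun m => if m = 0 then k else if m + k < n then 2 else 1 := by
    rw [← Finset.range_val, ← Nat.Iio_eq_range, ← Fin.map_valEmbedding_univ, Finset.map_val,
      Multiset.map_map]
    exact Multiset.map_congr rfl fun i _ => deg_spider hk hkn i
  rw [h1, h2]
  obtain ⟨d, rfl⟩ : ∃ d, n = 1 + d + k := ⟨n - k - 1, by omega⟩
  rw [Multiset.range_add, Multiset.range_add, Multiset.map_add, Multiset.map_add,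
    Multiset.map_map, Multiset.map_map, show 1 + d + k - k - 1 = d by omega, add_assoc,
    ← Multiset.singleton_add]
  congr 1
  congr 1
  · rw [Multiset.eq_replicate]
    refine ⟨by simp, fun b hb => ?_⟩
    obtain ⟨m, hm, rfl⟩ := Multiset.mem_map.1 hb
    rw [Multiset.mem_range] at hm
    simp only [Function.comp_apply]
    rw [if_neg (by omega), if_pos (by omega)]
  · rw [Multiset.eq_replicate]
    refine ⟨by simp, fun b hb => ?_⟩
    obtain ⟨m, hm, rfl⟩ := Multiset.mem_map.1 hb
    rw [Multiset.mem_range] at hm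
    simp only [Function.comp_apply]
    rw [if_neg (by omega), if_neg (by omega)]

theorem isBFDOrdering_of_iso_spider [Fintype V] [Nonempty V] {G : SimpleGraph V} {k : ℕ}
    (hk : 2 ≤ k) (hkn : k < Fintype.card V) (e : spider (Fintype.card V) k ≃g G) :
    IsBFDOrdering G e.symm.toEquiv := by
  have hadj : ∀ u v, G.Adj u v ↔ (0 < (e.symm u).val ∧ (e.symm u).val - k = (e.symm v).val) ∨
      (0 < (e.symm v).val ∧ (e.symm v).val - k = (e.symm u).val) := fun u v => by
    rw [← spider_adj (by omega), e.symm.map_adj_iff]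
  have hdiv : ∀ m, 0 < m → (m - k + k - 1) / k + 1 = (m + k - 1) / k := fun m hm => by
    rcases le_total k m with h | h
    · rw [show m + k - 1 = m - k + k - 1 + k by omega, Nat.add_div_right _ (by omega)]
    · rw [show m - k + k - 1 = k - 1 by omega, Nat.div_eq_of_lt (by omega),
        show m + k - 1 = m - 1 + k by omega, Nat.add_div_right _ (by omega),
        Nat.div_eq_of_lt (by omega)]
  have hsymm : ∀ i, e.symm (e i) = i := e.symm_apply_apply
  have hdist : ∀ v, G.dist (e ⟨0, Fintype.card_pos⟩) v = ((e.symm v).val + k - 1) / k := by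
    refine dist_eq_of_height (e.connected_iff.1 (spider_connected (by omega) Fintype.card_pos))
      (h := fun v => ((e.symm v).val + k - 1) / k) ?_ ?_ ?_
    · rw [hsymm]
      exact Nat.div_eq_of_lt (by simp only; omega)
    · intro u v huv
      rcases (hadj u v).1 huv with ⟨h1, h2⟩ | ⟨h1, h2⟩
      · have := hdiv _ h1
        rw [h2] at this
        omega
      · have := hdiv _ h1
        rw [h2] at this
        omega
    · intro v hv
      have hpos : 0 < (e.symm v).val := by
        rw [Nat.pos_iff_ne_zero]
        intro h
        exact hv (by rw [← e.apply_symm_apply v]; exact congrArg e (Fin.ext h))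
      refine ⟨e ⟨(e.symm v).val - k, by omega⟩, ?_, ?_⟩
      · rw [hadj, hsymm]
        exact Or.inr ⟨hpos, rfl⟩
      · rw [hsymm]
        exact hdiv _ hpos
  have hparent : ∀ w v, IsParent G e.symm.toEquiv w v →
      0 < (e.symm v).val ∧ (e.symm v).val - k = (e.symm w).val := by
    intro w v h
    refine ((hadj w v).1 h.1).resolve_left fun h1 => ?_
    have h2 : G.dist (e ⟨0, Fintype.card_pos⟩) w + 1 = G.dist (e ⟨0, Fintype.card_pos⟩) v := h.2.1
    have h3 := hdiv _ h1.1
    rw [hdist, hdist, ← h3, h1.2] at h2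
    omega
  refine ⟨fun u v huv => ?_, fun w₁ w₂ v₁ v₂ hw h₁ h₂ => ?_, fun u v huv => ?_⟩
  · have huv : (e.symm u).val ≤ (e.symm v).val := huv
    change G.dist (e ⟨0, _⟩) u ≤ G.dist (e ⟨0, _⟩) v
    rw [hdist, hdist]
    exact Nat.div_le_div_right (by omega)
  · have h1 := hparent _ _ h₁
    have h2 := hparent _ _ h₂
    have hw : (e.symm w₁).val < (e.symm w₂).val := hw
    change (e.symm v₁).val < (e.symm v₂).val
    omega
  · have huv : (e.symm u).val < (e.symm v).val := huv
    rw [← deg_iso e.symm v, ← deg_iso e.symm u, deg_spider (by omega) hkn,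
      deg_spider (by omega) hkn]
    split_ifs <;> omega

theorem card_filter_ord_lt [Fintype V] {n : ℕ} (ord : V ≃ Fin n) {a : ℕ} (ha : a ≤ n) :
    #(univ.filter fun v => (ord v).val < a) = a :=
  (Finset.card_equiv ord (by simp)).trans (card_filter_val_lt ha)

theorem mem_iff_ord_lt_card [Fintype V] {n : ℕ} (ord : V ≃ Fin n) {A : Finset V}
    (hA : ∀ u v, ord u ≤ ord v → v ∈ A → u ∈ A) (v : V) : v ∈ A ↔ (ord v).val < #A := by
  have hv := (ord v).isLt
  constructor
  · intro h
    rw [← Nat.succ_le_iff, ← card_filter_ord_lt ord (Nat.succ_le_of_lt hv)]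
    refine Finset.card_le_card fun u hu => hA u v ?_ h
    have := (Finset.mem_filter.1 hu).2
    rw [Fin.le_def]
    omega
  · contrapose!
    intro h
    rw [← card_filter_ord_lt ord hv.le]
    refine Finset.card_le_card fun u hu => ?_
    by_contra hlt
    refine h (hA v u ?_ hu)
    rw [Fin.le_def]
    simpa using hlt

theorem nonempty_iso_of_isBFDOrdering [Fintype V] [Nonempty V] {G : SimpleGraph V}
    (hG : G.IsTree) {k : ℕ} (hk : 2 ≤ k) (hkn : k < Fintype.card V)
    (hl : #(univ.filter fun v => deg G v = 1) = k) (hmem : k ∈ degMultiset G)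
    {ord : V ≃ Fin (Fintype.card V)} (hord : IsBFDOrdering G ord) :
    Nonempty (spider (Fintype.card V) k ≃g G) := by
  classical
  obtain ⟨-, hB1, hB2⟩ := hord
  have hcard : 1 < Fintype.card V := by omega
  have hB2' : ∀ u v, ord u ≤ ord v → deg G v ≤ deg G u := fun u v huv => by
    rcases huv.eq_or_lt with h | h
    · rw [ord.injective h]
    · exact hB2 u v h
  set r : V := ord.symm ⟨0, Fintype.card_pos⟩ with hr
  have hord0 : ∀ v, (ord v).val = 0 ↔ v = r := fun v => by
    rw [hr, Equiv.eq_symm_apply, Fin.ext_iff]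
  obtain ⟨p, hp⟩ := exists_parent hG.connected r
  have hadj := adj_iff_parent hG (h := G.dist r) (p := p) (r := r)
    fun v hv => ⟨(hp v hv).1, by have := (hp v hv).2; omega⟩
  have hdegr : deg G r = k := by
    obtain ⟨x, -, hx⟩ := Multiset.mem_map.1 hmem
    have h1 := hB2' r x (by rw [Fin.le_def, (hord0 r).2 rfl]; exact Nat.zero_le _)
    have h2 := sum_deg_le hG hcard hl {r}
    simp only [Finset.sum_singleton, Finset.card_singleton] at h2
    omega
  have hdeg2 : ∀ v, v ≠ r → (ord v).val < Fintype.card V - k → deg G v = 2 := by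
    intro v hv hlt
    have h1 := sum_deg_le hG hcard hl {r, v}
    rw [Finset.sum_pair hv.symm, Finset.card_pair hv.symm, hdegr] at h1
    have h2 := deg_pos hG.connected hcard v
    have h3 := mem_iff_ord_lt_card ord (A := (univ.filter fun v => deg G v = 1)ᶜ) (by
      intro u v huv
      have h3 := hB2' u v huv
      have h4 := deg_pos hG.connected hcard v
      simp only [Finset.mem_compl, Finset.mem_filter, Finset.mem_univ, true_and]
      omega) v
    rw [Finset.card_compl, hl] at h3
    have h4 := h3.2 hlt
    simp only [Finset.mem_compl, Finset.mem_filter, Finset.mem_univ, true_and] at h4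
    omega
  have hparent : ∀ v, v ≠ r → IsParent G ord (p v) v := by
    intro v hv
    refine ⟨(hp v hv).1.symm, (hp v hv).2, fun w hwv hw => ?_⟩
    change G.dist r w + 1 = G.dist r v at hw
    rcases (hadj w v).1 hwv with ⟨h1, rfl⟩ | ⟨-, rfl⟩
    · have := (hp w h1).2
      omega
    · exact le_rfl
  have hmono : ∀ u v, u ≠ r → v ≠ r → ord u ≤ ord v → ord (p u) ≤ ord (p v) := by
    intro u v hu hv huv
    by_contra! h
    exact (hB1 _ _ _ _ h (hparent v hv) (hparent u hu)).not_ge huv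
  have hchildren : ∀ x, (ord x).val < Fintype.card V - k →
      #(univ.filter fun u => u ≠ r ∧ p u = x) = 1 + if x = r then k - 1 else 0 := by
    intro x hx
    by_cases hxr : x = r
    · have : (univ.filter fun u => u ≠ r ∧ p u = x) = univ.filter fun u => G.Adj x u := by
        ext u
        simp [hadj, hxr]
      rw [this, ← deg_eq_card, hxr, hdegr, if_pos rfl]
      omega
    · have : insert (p x) (univ.filter fun u => u ≠ r ∧ p u = x) =
          univ.filter fun u => G.Adj x u := by
        ext u
        simp [hadj, hxr, eq_comm (a := u)]
      have h1 := hdeg2 x hxr hx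
      rw [deg_eq_card, ← this, Finset.card_insert_of_notMem] at h1
      · rw [if_neg hxr]
        omega
      · intro h
        obtain ⟨-, h2, h3⟩ := Finset.mem_filter.1 h
        have h4 := (hp _ h2).2
        have h5 := (hp x hxr).2
        rw [h3] at h4
        omega
  have hcount : ∀ i, i + k < Fintype.card V → ∀ v, v ≠ r →
      ((ord (p v)).val ≤ i ↔ (ord v).val ≤ i + k) := by
    intro i hi v hv
    set X := univ.filter fun x => (ord x).val < i + 1 with hX
    set T := univ.filter fun u => u ≠ r ∧ (ord (p u)).val ≤ i with hT
    have hcardT : #T = i + k := by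
      rw [Finset.card_eq_sum_card_fiberwise (f := p) (t := X) (fun u hu => by
        have := (Finset.mem_filter.1 (Finset.mem_coe.1 hu)).2.2
        simp [hX]
        omega)]
      have hfib : ∀ x ∈ X, #(T.filter fun u => p u = x) = 1 + if x = r then k - 1 else 0 := by
        intro x hx
        have hx := (Finset.mem_filter.1 hx).2
        rw [← hchildren x (by omega)]
        congr 1
        ext u
        simp only [hT, Finset.mem_filter, Finset.mem_univ, true_and]
        refine ⟨fun h => ⟨h.1.1, h.2⟩, fun h => ⟨⟨h.1, ?_⟩, h.2⟩⟩
        rw [h.2]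
        omega
      rw [Finset.sum_congr rfl hfib, Finset.sum_add_distrib, Finset.sum_ite_eq', if_pos,
        Finset.sum_const, card_filter_ord_lt ord (by omega), smul_eq_mul]
      · omega
      · simp [hX, (hord0 r).2 rfl]
    have h := mem_iff_ord_lt_card ord (A := insert r T) (by
      intro u w huw hw
      by_cases hu : u = r
      · simp [hu]
      · have hwr : w ≠ r := by
          intro h
          rw [h, Fin.le_def, (hord0 r).2 rfl] at huw
          exact hu ((hord0 u).1 (by omega))
        have hw := (Finset.mem_filter.1 (Finset.mem_of_mem_insert_of_ne hw hwr)).2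
        have h1 : (ord (p u)).val ≤ (ord (p w)).val := hmono u w hu hwr huw
        exact Finset.mem_insert_of_mem
          (Finset.mem_filter.2 ⟨Finset.mem_univ _, hu, h1.trans hw.2⟩)) v
    rw [Finset.card_insert_of_notMem (by simp [hT]), hcardT, Nat.lt_succ_iff] at h
    rw [← h]
    simp [hT, hv]
  refine nonempty_iso_of_parent (by omega) rfl hadj
    (w := fun j => if h : j < Fintype.card V then ord.symm ⟨j, h⟩ else r) ?_ ?_ ?_
  · simp only [Fintype.card_pos, dif_pos, hr]
  · intro j hj hj0
    simp only [hj, dif_pos, lt_of_le_of_lt (Nat.sub_le j k) hj]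
    have hne : ord.symm ⟨j, hj⟩ ≠ r := by
      rw [Ne, ← hord0, Equiv.apply_symm_apply]
      simp only
      omega
    refine ⟨hne, ?_⟩
    rw [Equiv.eq_symm_apply, Fin.ext_iff]
    simp only
    have h1 := hcount (j - k) (by omega) _ hne
    rw [Equiv.apply_symm_apply] at h1
    simp only at h1
    rcases Nat.eq_zero_or_pos (j - k) with h0 | h0
    · have := h1.2 (by omega)
      omega
    · have h2 := hcount (j - k - 1) (by omega) _ hne
      rw [Equiv.apply_symm_apply] at h2
      simp only at h2
      omega
  · intro i hi j hj hij
    have hi := (Finset.mem_Icc.1 (Finset.mem_coe.1 hi)).2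
    have hj := (Finset.mem_Icc.1 (Finset.mem_coe.1 hj)).2
    simp only [lt_of_le_of_lt hi hkn, lt_of_le_of_lt hj hkn, dif_pos] at hij
    exact Fin.ext_iff.1 (ord.symm.injective hij)

end Extremal

end BalancedSpider

/-- A tree `G` with `n` vertices and exactly `k` leaves has greatest
spectral radius among all such trees iff it is the spider obtained from the star
`K_{1,k}` by attaching paths of almost equal lengths; equivalently, iff it has
degree sequence `(k, 2, …, 2, 1, …, 1)` and admits a BFD-ordering. -/
theorem tree_max_spectral_radius_iff_balanced_spider [Fintype V] [DecidableEq V] [Nonempty V]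
    (G : SimpleGraph V) (hG : G.IsTree) (k : ℕ)
    (hk2 : 2 ≤ k) (hkn : k ≤ Fintype.card V - 1)
    (hkleaves : (Finset.univ.filter (fun v => deg G v = 1)).card = k) :
    (∀ H : SimpleGraph V, H.IsTree →
        (Finset.univ.filter (fun v => deg H v = 1)).card = k →
        specRad H ≤ specRad G) ↔
      (degMultiset G =
          k ::ₘ (Multiset.replicate (Fintype.card V - k - 1) 2 + Multiset.replicate k 1) ∧
        ∃ ord : V ≃ Fin (Fintype.card V), IsBFDOrdering G ord) := by
  have hkn' : k < Fintype.card V := by omega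
  constructor
  · intro hmax
    set iso := SimpleGraph.Iso.comap (Fintype.equivFin V)
      (BalancedSpider.spider (Fintype.card V) k)
    have h1 := hmax _ (iso.isTree_iff.2 (BalancedSpider.spider_isTree (by omega) hkn'))
      ((BalancedSpider.card_leaves_iso iso).trans (BalancedSpider.card_leaves_spider hk2 hkn'))
    rw [BalancedSpider.specRad_eq_of_iso iso] at h1
    have h2 := BalancedSpider.specRad_le_spider hk2 hkn' hG hkleaves
    obtain ⟨e⟩ := h2.2 (le_antisymm h2.1 h1)
    exact ⟨BalancedSpider.degMultiset_of_iso_spider (by omega) hkn' e, _,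
      BalancedSpider.isBFDOrdering_of_iso_spider hk2 hkn' e⟩
  · rintro ⟨hdeg, ord, hord⟩ H hH hHk
    obtain ⟨e⟩ := BalancedSpider.nonempty_iso_of_isBFDOrdering hG hk2 hkn' hkleaves
      (by rw [hdeg]; exact Multiset.mem_cons_self _ _) hord
    rw [← BalancedSpider.specRad_eq_of_iso e]
    exact (BalancedSpider.specRad_le_spider hk2 hkn' hH hHk).1
end

section
/- Among all degree sequences of trees with n vertices having exactly k entries equal to 1 (i.e., trees with exactly k leaves, 2 ≤ k ≤ n−1), the sequence π* = (k, 2, …, 2, 1, …, 1) (one entry k, then n−k−1 entries 2, then k entries 1) is the maximum with respect to the majorization order: for every such tree degree sequence π with π ≠ π*, one has π ◁ π*. -/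
open Finset

variable {V : Type*} {W : Type*}

/-- The sum of `n` terms of a sequence whose first `a` entries are `2` and the others `1`. -/
theorem sum_range_ite_two_one (a n : ℕ) :
    ∑ i ∈ Finset.range n, (if i < a then 2 else 1) = n + min a n := by
  induction n with
  | zero => simp
  | succ n ih =>
    rw [Finset.sum_range_succ, ih]
    split_ifs <;> omega

theorem sum_star_seq {n k : ℕ} (hk2 : 2 ≤ k) (hkn : k ≤ n - 1) :
    ∑ i : Fin n, (if (i : ℕ) = 0 then k else if (i : ℕ) < n - k then 2 else 1) =
      2 * (n - 1) := by
  rw [Fin.sum_univ_eq_sum_range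
    (fun i => if i = 0 then k else if i < n - k then 2 else 1) n]
  obtain ⟨m, rfl⟩ : ∃ m, n = m + 1 := ⟨n - 1, by omega⟩
  rw [Finset.sum_range_succ']
  have h : ∀ i, (i + 1 < m + 1 - k) ↔ i < m - k := by omega
  simp only [Nat.add_eq_zero_iff, one_ne_zero, and_false, if_false, if_true, h]
  rw [sum_range_ite_two_one]
  omega

/-- In a positive non-increasing sequence with `k` ones, all but the last `k` entries are
at least `2`. -/
theorem two_le_of_lt_sub_card_ones {n : ℕ} {d : Fin n → ℕ} (hanti : Antitone d)
    (hpos : ∀ i, 0 < d i) {i : Fin n}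
    (hi : (i : ℕ) < n - (Finset.univ.filter (fun i => d i = 1)).card) : 2 ≤ d i := by
  by_contra! h
  have hsub : Finset.Ici i ⊆ Finset.univ.filter (fun i => d i = 1) := by
    intro l hl
    have h₁ := hanti (Finset.mem_Ici.mp hl)
    have h₂ := hpos l
    simp only [Finset.mem_filter, Finset.mem_univ, true_and]
    omega
  have hcard := Finset.card_le_card hsub
  rw [Fin.card_Ici] at hcard
  omega

/-- Among all tree degree sequences of length `n` with exactly `k`
entries equal to `1` (`2 ≤ k ≤ n-1`), the sequence `π* = (k, 2, …, 2, 1, …, 1)` is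
the maximum with respect to majorization. -/
theorem star_seq_maximal {n k : ℕ} (hk2 : 2 ≤ k) (hkn : k ≤ n - 1)
    (d : Fin n → ℕ) (hd : IsTreeDegSeq d)
    (hleaves : (Finset.univ.filter (fun i => d i = 1)).card = k)
    (hne : d ≠ fun i : Fin n =>
      if (i : ℕ) = 0 then k else if (i : ℕ) < n - k then 2 else 1) :
    ∀ j : Fin n, ∑ i ∈ Finset.Iic j, d i ≤
      ∑ i ∈ Finset.Iic j,
        (if (i : ℕ) = 0 then k else if (i : ℕ) < n - k then 2 else 1) := by
  intro j
  obtain ⟨hanti, hpos, hsum⟩ := hd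
  have htail : ∑ i ∈ Finset.Ioi j,
      (if (i : ℕ) = 0 then k else if (i : ℕ) < n - k then 2 else 1) ≤
      ∑ i ∈ Finset.Ioi j, d i := by
    refine Finset.sum_le_sum fun i hi => ?_
    have hji : j < i := Finset.mem_Ioi.mp hi
    rw [if_neg (by omega)]
    split_ifs with h
    · exact two_le_of_lt_sub_card_ones hanti hpos (by rwa [hleaves])
    · exact hpos i
  have hsplit (f : Fin n → ℕ) :
      ∑ i ∈ Finset.Iic j, f i + ∑ i ∈ Finset.Ioi j, f i = ∑ i, f i := by
    rw [← Finset.sum_add_sum_compl (Finset.Iic j)]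
    congr 2
    ext i
    simp
  have hd := hsplit d
  have hstar := hsplit fun i => if (i : ℕ) = 0 then k else if (i : ℕ) < n - k then 2 else 1
  rw [sum_star_seq hk2 hkn] at hstar
  omega
end

section
/- Switching lemma: Let G = (V, E) be a connected finite simple graph with edges v1u1, v2u2 ∈ E such that v1v2 ∉ E and u1u2 ∉ E (and the four vertices v1, u1, v2, u2 are distinct). Let G' = (V, E') be the graph obtained by replacing edges v1u1 and v2u2 with edges v1v2 and u1u2; then G' has the same degree sequence as G. Let f be the Perron vector of G. If f(v1) ≥ f(u2) and f(v2) ≥ f(u1), then λ(G') ≥ λ(G), and the inequality λ(G') > λ(G) holds if and only if at least one of the two inequalities f(v1) ≥ f(u2), f(v2) ≥ f(u1) is strict. -/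
open Finset

variable {V : Type*} {W : Type*}

/-- The Rayleigh bound for the spectral radius: `λ(G) I - A(G)` is positive semidefinite. -/
lemma posSemidef_specRad_sub_adjMat [Fintype V] [DecidableEq V] (G : SimpleGraph V) :
    (specRad G • (1 : Matrix V V ℝ) - adjMat G).PosSemidef := by
  have hA : (adjMat G).IsHermitian := by
    classical
    ext a b
    simp [adjMat, SimpleGraph.adj_comm]
  have hH : (specRad G • (1 : Matrix V V ℝ) - adjMat G).IsHermitian := by
    refine Matrix.IsHermitian.sub ?_ hA
    ext a b
    simp [Matrix.one_apply, eq_comm]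
  have hbdd : BddAbove {μ : ℝ | ∃ f : V → ℝ, f ≠ 0 ∧ (adjMat G).mulVec f = μ • f} := by
    refine ((Module.End.finite_hasEigenvalue (Matrix.toLin' (adjMat G))).subset ?_).bddAbove
    rintro μ ⟨f, hf0, hf⟩
    exact Module.End.hasEigenvalue_of_hasEigenvector
      (x := f)
      (Module.End.hasEigenvector_iff.2 ⟨Module.End.mem_eigenspace_iff.2 (by simpa using hf), hf0⟩)
  rw [hH.posSemidef_iff_eigenvalues_nonneg]
  intro i
  have hg := hH.mulVec_eigenvectorBasis i
  set g : V → ℝ := ⇑(hH.eigenvectorBasis i)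
  have hg0 : g ≠ 0 := by
    intro h
    refine hH.eigenvectorBasis.orthonormal.ne_zero i ?_
    ext v
    exact congrFun h v
  have hle : specRad G - hH.eigenvalues i ≤ specRad G := by
    refine le_csSup hbdd ⟨g, hg0, ?_⟩
    rw [Matrix.sub_mulVec, Matrix.smul_mulVec, Matrix.one_mulVec] at hg
    rw [sub_smul, ← hg]
    abel
  simpa using hle

/-- An eigenvalue with a positive eigenvector is the spectral radius. -/
lemma specRad_eq_of_pos_eigenvector [Fintype V] [Nonempty V] (G : SimpleGraph V)
    {f : V → ℝ} {c : ℝ}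
    (hpos : ∀ v, 0 < f v) (hf : (adjMat G).mulVec f = c • f) : specRad G = c := by
  classical
  have hsymm : ∀ a b, adjMat G a b = adjMat G b a := fun a b => by
    simp [adjMat, SimpleGraph.adj_comm]
  have hnonneg : ∀ a b, 0 ≤ adjMat G a b := fun a b => by
    simp only [adjMat, SimpleGraph.adjMatrix_apply]
    split_ifs <;> norm_num
  refine IsGreatest.csSup_eq ⟨⟨f, ?_, hf⟩, ?_⟩
  · intro h
    obtain ⟨v⟩ := ‹Nonempty V›
    exact (hpos v).ne' (congrFun h v)
  rintro μ ⟨g, hg0, hg⟩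
  obtain ⟨w, hw⟩ := Function.ne_iff.1 hg0
  have hS : 0 < ∑ v, f v * |g v| :=
    Finset.sum_pos' (fun v _ => mul_nonneg (hpos v).le (abs_nonneg _))
      ⟨w, Finset.mem_univ w, mul_pos (hpos w) (abs_pos.2 hw)⟩
  refine le_of_mul_le_mul_right ?_ hS
  calc μ * ∑ v, f v * |g v| = ∑ v, f v * (μ * |g v|) := by
        rw [Finset.mul_sum]; exact Finset.sum_congr rfl fun v _ => by ring
    _ ≤ ∑ v, f v * ∑ u, adjMat G v u * |g u| := by
        refine Finset.sum_le_sum fun v _ => mul_le_mul_of_nonneg_left ?_ (hpos v).le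
        have hv : ∑ u, adjMat G v u * g u = μ * g v := congrFun hg v
        calc μ * |g v| ≤ |μ * g v| := by
              rw [abs_mul]; exact mul_le_mul_of_nonneg_right (le_abs_self μ) (abs_nonneg _)
          _ ≤ ∑ u, |adjMat G v u * g u| := hv ▸ Finset.abs_sum_le_sum_abs _ _
          _ = ∑ u, adjMat G v u * |g u| :=
              Finset.sum_congr rfl fun u _ => by rw [abs_mul, abs_of_nonneg (hnonneg v u)]
    _ = ∑ u, (∑ v, adjMat G u v * f v) * |g u| := by
        simp_rw [Finset.mul_sum, Finset.sum_mul]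
        rw [Finset.sum_comm]
        refine Finset.sum_congr rfl fun u _ => Finset.sum_congr rfl fun v _ => ?_
        rw [hsymm u v]; ring
    _ = c * ∑ v, f v * |g v| := by
        rw [Finset.mul_sum]
        refine Finset.sum_congr rfl fun u _ => ?_
        have hu : ∑ v, adjMat G u v * f v = c * f u := congrFun hf u
        rw [hu]; ring

/-- The degree is the row sum of the adjacency matrix. -/
lemma adjMat_mulVec_one [Fintype V] (G : SimpleGraph V) (v : V) :
    (adjMat G).mulVec 1 v = deg G v := by
  classical
  simp [adjMat, deg, Matrix.mulVec, dotProduct, SimpleGraph.adjMatrix_apply,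
    ← SimpleGraph.card_neighborFinset_eq_degree, SimpleGraph.neighborFinset_eq_filter]

/-- The effect of a switching on the adjacency matrix. -/
lemma adjMat_switched [Fintype V] [DecidableEq V] (G : SimpleGraph V) {v1 u1 v2 u2 : V}
    (hdist : [v1, u1, v2, u2].Pairwise (· ≠ ·))
    (h1 : G.Adj v1 u1) (h2 : G.Adj v2 u2) (h3 : ¬ G.Adj v1 v2) (h4 : ¬ G.Adj u1 u2) :
    adjMat (switched G v1 u1 v2 u2) = adjMat G
      + (Matrix.single v1 v2 1 - Matrix.single v1 u1 1)
      + (Matrix.single v2 v1 1 - Matrix.single v2 u2 1)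
      + (Matrix.single u1 u2 1 - Matrix.single u1 v1 1)
      + (Matrix.single u2 u1 1 - Matrix.single u2 v2 1) := by
  classical
  simp only [List.pairwise_cons, List.mem_cons, List.not_mem_nil, or_false, forall_eq_or_imp,
    forall_eq] at hdist
  have h1' := h1.symm
  have h2' := h2.symm
  have h3' : ¬ G.Adj v2 v1 := fun h => h3 h.symm
  have h4' : ¬ G.Adj u2 u1 := fun h => h4 h.symm
  ext a b
  have hadj : (switched G v1 u1 v2 u2).Adj a b ↔
      (G.Adj a b ∧ ¬ (s(a, b) = s(v1, u1) ∨ s(a, b) = s(v2, u2)) ∨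
        (s(a, b) = s(v1, v2) ∨ s(a, b) = s(u1, u2))) ∧ a ≠ b := Iff.rfl
  simp only [Sym2.eq_iff] at hadj
  simp only [adjMat, SimpleGraph.adjMatrix_apply, Matrix.add_apply, Matrix.sub_apply,
    Matrix.single_apply, hadj]
  have hne : G.Adj a b → a ≠ b := fun h => h.ne
  grind (splits := 30)

lemma adjMat_switched_mulVec [Fintype V] [DecidableEq V] (G : SimpleGraph V) {v1 u1 v2 u2 : V}
    (hdist : [v1, u1, v2, u2].Pairwise (· ≠ ·))
    (h1 : G.Adj v1 u1) (h2 : G.Adj v2 u2) (h3 : ¬ G.Adj v1 v2) (h4 : ¬ G.Adj u1 u2)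
    (g : V → ℝ) :
    (adjMat (switched G v1 u1 v2 u2)).mulVec g = (adjMat G).mulVec g
      + Pi.single v1 (g v2 - g u1) + Pi.single v2 (g v1 - g u2)
      + Pi.single u1 (g u2 - g v1) + Pi.single u2 (g u1 - g v2) := by
  rw [adjMat_switched G hdist h1 h2 h3 h4]
  simp only [Matrix.add_mulVec, Matrix.sub_mulVec, Matrix.single_mulVec, Pi.single_sub, one_mul]
  rfl

/-- (Switching lemma.) Replacing edges `v1u1`, `v2u2` by `v1v2`,
`u1u2` preserves the degree sequence; if the Perron vector `f` of `G` satisfies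
`f(v1) ≥ f(u2)` and `f(v2) ≥ f(u1)`, then `λ(G') ≥ λ(G)`, with strict inequality iff
at least one of the two inequalities is strict. -/
theorem switching_lemma [Fintype V] [DecidableEq V]
    (G : SimpleGraph V) (hconn : G.Connected) (v1 u1 v2 u2 : V)
    (hdist : [v1, u1, v2, u2].Pairwise (· ≠ ·))
    (h1 : G.Adj v1 u1) (h2 : G.Adj v2 u2)
    (h3 : ¬ G.Adj v1 v2) (h4 : ¬ G.Adj u1 u2)
    (f : V → ℝ) (hf : IsPerronVector G f)
    (hf1 : f u2 ≤ f v1) (hf2 : f u1 ≤ f v2) :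
    degMultiset (switched G v1 u1 v2 u2) = degMultiset G ∧
    specRad G ≤ specRad (switched G v1 u1 v2 u2) ∧
    (specRad G < specRad (switched G v1 u1 v2 u2) ↔ (f u2 < f v1 ∨ f u1 < f v2)) := by
  have hmv := adjMat_switched_mulVec G hdist h1 h2 h3 h4
  simp only [List.pairwise_cons, List.mem_cons, List.not_mem_nil, or_false, forall_eq_or_imp,
    forall_eq] at hdist
  obtain ⟨⟨hv1u1, hv1v2, hv1u2⟩, ⟨hu1v2, hu1u2⟩, hv2u2, -⟩ := hdist
  obtain ⟨hpos, hunit, heig⟩ := hf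
  have : Nonempty V := ⟨v1⟩
  set G' := switched G v1 u1 v2 u2
  have hdeg : degMultiset G' = degMultiset G := by
    refine congrArg (Multiset.map · _) (funext fun v => ?_)
    have := congrFun (hmv 1) v
    simpa [adjMat_mulVec_one] using this
  have hPSD := posSemidef_specRad_sub_adjMat G'
  have hS : (specRad G' • (1 : Matrix V V ℝ) - adjMat G').mulVec f =
      specRad G' • f - (adjMat G').mulVec f := by
    rw [Matrix.sub_mulVec, Matrix.smul_mulVec, Matrix.one_mulVec]
  have hff : f ⬝ᵥ f = 1 := by
    rw [← hunit]
    exact Finset.sum_congr rfl fun v _ => (sq (f v)).symm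
  have hquad : f ⬝ᵥ (specRad G' • (1 : Matrix V V ℝ) - adjMat G').mulVec f =
      specRad G' - specRad G - 2 * ((f v1 - f u2) * (f v2 - f u1)) := by
    rw [hS, hmv, heig]
    simp only [dotProduct_sub, dotProduct_add, dotProduct_smul, dotProduct_single, hff, smul_eq_mul]
    ring
  have hprod := mul_nonneg (sub_nonneg.2 hf1) (sub_nonneg.2 hf2)
  have hnonneg := hPSD.dotProduct_mulVec_nonneg f
  rw [star_trivial, hquad] at hnonneg
  refine ⟨hdeg, by linarith, fun hlt => ?_, fun hstrict => ?_⟩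
  · by_contra! h
    have e1 : f v1 = f u2 := le_antisymm h.1 hf1
    have e2 : f v2 = f u1 := le_antisymm h.2 hf2
    have heig' : (adjMat G').mulVec f = specRad G • f := by
      rw [hmv, heig, e1, e2]
      simp
    exact hlt.ne' (specRad_eq_of_pos_eigenvector G' hpos heig')
  · refine lt_of_le_of_ne (by linarith) fun heq => ?_
    have hzero := (hPSD.dotProduct_mulVec_zero_iff f).1 (by
      rw [star_trivial, hquad]
      linarith)
    rw [hS, hmv, heig, ← heq] at hzero
    have hz1 := congrFun hzero v1
    have hz2 := congrFun hzero v2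
    simp [hv1u1, hv1v2, hv1u2] at hz1
    simp [hv1v2.symm, hu1v2.symm, hv2u2] at hz2
    rcases hstrict with h | h <;> linarith
end

section
/- Shifting lemma: Let G = (V, E) be a connected finite simple graph with uv1 ∈ E and uv2 ∉ E (u, v1, v2 distinct), and let G' = (V, E') be the graph obtained by replacing the edge uv1 with the edge uv2. Let f be the Perron vector of G. If f(v2) ≥ f(v1), then λ(G') > λ(G). -/
open Finset

variable {V : Type*} {W : Type*}

/-- The set of eigenvalues of a real square matrix is bounded above. -/
lemma bddAbove_matrix_eigenvalues [Fintype V] (A : Matrix V V ℝ) :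
    BddAbove {μ : ℝ | ∃ f : V → ℝ, f ≠ 0 ∧ A.mulVec f = μ • f} := by
  refine ((Module.End.finite_hasEigenvalue A.mulVecLin).subset ?_).bddAbove
  rintro μ ⟨f, hf, h⟩
  exact Module.End.hasEigenvalue_of_hasEigenvector
    ⟨Module.End.mem_eigenspace_iff.mpr (by simpa using h), hf⟩

/-- The effect of shifting on the action of the adjacency matrix. -/
lemma adjMat_shifted_mulVec [Fintype V] [DecidableEq V] (G : SimpleGraph V) {u v1 v2 : V}
    (huv2 : u ≠ v2) (hv12 : v1 ≠ v2) (h1 : G.Adj u v1) (h2 : ¬ G.Adj u v2) (f : V → ℝ) :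
    (adjMat (shifted G u v1 v2)).mulVec f = (adjMat G).mulVec f
      + (Pi.single v2 (f u) - Pi.single v1 (f u) + Pi.single u (f v2 - f v1)) := by
  have huv1 : u ≠ v1 := h1.ne
  have hmat : adjMat (shifted G u v1 v2) = adjMat G
      + (Matrix.single v2 u 1 - Matrix.single v1 u 1
        + (Matrix.single u v2 1 - Matrix.single u v1 1)) := by
    classical
    have hv1u := h1.symm
    have hv2u : ¬ G.Adj v2 u := fun h => h2 h.symm
    have hloop : ∀ i, ¬ G.Adj i i := fun i => G.irrefl
    ext i j
    have hadj : (shifted G u v1 v2).Adj i j ↔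
        (G.Adj i j ∧ ¬ (i = u ∧ j = v1 ∨ i = v1 ∧ j = u)
          ∨ (i = u ∧ j = v2 ∨ i = v2 ∧ j = u)) ∧ i ≠ j := by
      simp only [shifted, SimpleGraph.fromEdgeSet_adj, Set.mem_union, Set.mem_sdiff,
        SimpleGraph.mem_edgeSet, Set.mem_singleton_iff, Sym2.eq_iff]
    simp only [adjMat, SimpleGraph.adjMatrix_apply, Matrix.add_apply, Matrix.sub_apply,
      Matrix.single_apply]
    grind
  rw [hmat, Matrix.add_mulVec, Matrix.add_mulVec, Matrix.sub_mulVec, Matrix.sub_mulVec]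
  congr 1
  ext i
  simp [Matrix.single_mulVec, Function.update_apply, Pi.single_apply]
  split_ifs <;> simp

/-- (Shifting lemma.) If `uv1 ∈ E`, `uv2 ∉ E` and the Perron vector
`f` of the connected graph `G` satisfies `f(v2) ≥ f(v1)`, then replacing the edge
`uv1` by `uv2` strictly increases the spectral radius. -/
theorem shifting_lemma [Fintype V] [DecidableEq V]
    (G : SimpleGraph V) (hconn : G.Connected) (u v1 v2 : V)
    (huv2 : u ≠ v2) (hv12 : v1 ≠ v2)
    (h1 : G.Adj u v1) (h2 : ¬ G.Adj u v2)
    (f : V → ℝ) (hf : IsPerronVector G f) (hle : f v1 ≤ f v2) :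
    specRad G < specRad (shifted G u v1 v2) := by
  obtain ⟨hpos, hnorm, hev⟩ := hf
  by_contra! hlt
  have hpsd := posSemidef_specRad_sub_adjMat (shifted G u v1 v2)
  have hshift := adjMat_shifted_mulVec G huv2 hv12 h1 h2 f
  have hff : f ⬝ᵥ f = 1 := by simpa [dotProduct, sq] using hnorm
  have hquad : star f ⬝ᵥ
      (specRad (shifted G u v1 v2) • (1 : Matrix V V ℝ) - adjMat (shifted G u v1 v2)).mulVec f
      = specRad (shifted G u v1 v2) - specRad G - 2 * (f u * (f v2 - f v1)) := by
    rw [Matrix.sub_mulVec, Matrix.smul_mulVec, Matrix.one_mulVec, hshift, hev, star_trivial]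
    simp only [dotProduct_sub, dotProduct_add, dotProduct_smul, dotProduct_single, hff,
      smul_eq_mul]
    ring
  have hgain : 0 ≤ f u * (f v2 - f v1) := mul_nonneg (hpos u).le (sub_nonneg.mpr hle)
  have hnonneg := hpsd.dotProduct_mulVec_nonneg f
  have heq : specRad (shifted G u v1 v2) = specRad G := by linarith
  have hker := (hpsd.dotProduct_mulVec_zero_iff f).mp (by linarith)
  rw [Matrix.sub_mulVec, Matrix.smul_mulVec, Matrix.one_mulVec, hshift, hev, heq] at hker
  have hat := congrFun hker v2
  simp [huv2.symm, hv12.symm] at hat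
  exact (hpos u).ne' hat
end

section
/- Let f be the Perron vector of a connected finite simple graph G with degree sequence π, and let u and v be two vertices with d(u) > d(v). If f(u) < f(v), then G does not have greatest spectral radius in the class C_π of all connected graphs with degree sequence π; that is, there exists a connected graph G' with the same degree sequence π and λ(G') > λ(G). -/
open Finset

variable {V : Type*} {W : Type*}

/-- The quadratic form of a symmetric real matrix is at most its largest eigenvalue times the
squared norm, the largest eigenvalue being the supremum of the set of eigenvalues. -/
theorem Matrix.IsSymm.dotProduct_mulVec_le_sSup [Fintype V] [DecidableEq V]
    {A : Matrix V V ℝ} (hA : A.IsSymm) (f : V → ℝ) (hf : ∑ x, f x ^ 2 = 1) :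
    f ⬝ᵥ A.mulVec f ≤ sSup {μ : ℝ | ∃ g : V → ℝ, g ≠ 0 ∧ A.mulVec g = μ • g} := by
  have hne : WithLp.toLp 2 f ≠ 0 := by
    intro h
    have h0 : f = 0 := by simpa using h
    simp [h0] at hf
  have : Nontrivial (EuclideanSpace ℝ V) := ⟨_, _, hne⟩
  have hsym : (Matrix.toEuclideanLin A).IsSymmetric :=
    Matrix.isSymmetric_toEuclideanLin_iff.mpr (by simpa [Matrix.IsHermitian] using hA.eq)
  obtain ⟨g, hg⟩ := hsym.hasEigenvalue_iSup_of_finiteDimensional.exists_hasEigenvector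
  have hnorm : ‖WithLp.toLp 2 f‖ ^ 2 = 1 := by
    simp [EuclideanSpace.norm_sq_eq, hf]
  have hbdd : BddAbove (Set.range fun x : {x : EuclideanSpace ℝ V // x ≠ 0} =>
      (RCLike.re (inner ℝ (Matrix.toEuclideanLin A x) (x : EuclideanSpace ℝ V)) /
        ‖(x : EuclideanSpace ℝ V)‖ ^ 2 : ℝ)) := by
    refine ⟨‖Matrix.toEuclideanCLM (n := V) (𝕜 := ℝ) A‖, ?_⟩
    rintro _ ⟨x, rfl⟩
    exact (le_abs_self _).trans
      ((Matrix.toEuclideanCLM (n := V) (𝕜 := ℝ) A).rayleighQuotient_le_norm x)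
  have hle := le_ciSup hbdd ⟨WithLp.toLp 2 f, hne⟩
  have hval : f ⬝ᵥ A.mulVec f = (RCLike.re (inner ℝ (Matrix.toEuclideanLin A (WithLp.toLp 2 f))
      (WithLp.toLp 2 f)) / ‖WithLp.toLp 2 f‖ ^ 2 : ℝ) := by
    rw [hnorm]
    simp [EuclideanSpace.inner_eq_star_dotProduct]
  rw [hval]
  refine hle.trans (le_csSup ?_ ?_)
  · refine (Module.End.finite_spectrum (Matrix.toLin' A)).bddAbove.mono ?_
    rintro μ ⟨g, hg0, hg⟩
    exact (Module.End.hasEigenvalue_of_hasEigenvector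
      ⟨Module.End.mem_eigenspace_iff.mpr (by simpa using hg), hg0⟩).mem_spectrum
  · refine ⟨WithLp.ofLp g, by simpa using hg.2, ?_⟩
    have := congrArg WithLp.ofLp hg.apply_eq_smul
    simpa using this

/-- The graph obtained from `G` by replacing the edges from `u` to the vertices of `S` by edges
from `v` to the vertices of `S`. -/
def SimpleGraph.moveNeighbors (G : SimpleGraph V) (u v : V) (S : Finset V) : SimpleGraph V where
  Adj a b := a ≠ b ∧ ((G.Adj a b ∧ ¬(a = u ∧ b ∈ S) ∧ ¬(b = u ∧ a ∈ S)) ∨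
    (a = v ∧ b ∈ S) ∨ (b = v ∧ a ∈ S))
  symm := ⟨fun a b h => ⟨h.1.symm, by have := G.adj_comm a b; tauto⟩⟩
  loopless := ⟨fun a h => h.1 rfl⟩

theorem adjMat_apply [Fintype V] (G : SimpleGraph V) (a b : V) [Decidable (G.Adj a b)] :
    adjMat G a b = if G.Adj a b then 1 else 0 := by
  simp only [adjMat, SimpleGraph.adjMatrix_apply]
  congr

theorem adjMat_isSymm [Fintype V] (G : SimpleGraph V) : (adjMat G).IsSymm := by
  classical
  ext a b
  simp only [Matrix.transpose_apply, adjMat_apply, G.adj_comm]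

theorem deg_eq_sum_adjMat [Fintype V] (G : SimpleGraph V) (a : V) :
    (deg G a : ℝ) = ∑ b, adjMat G a b := by
  classical
  simp only [adjMat_apply, deg]
  rw [Finset.sum_boole, ← SimpleGraph.card_neighborFinset_eq_degree,
    SimpleGraph.neighborFinset_eq_filter]

/-- The vertices of `S` are adjacent to `u`, and neither adjacent nor equal to `v`. -/
def Movable (G : SimpleGraph V) (u v : V) (S : Finset V) : Prop :=
  ∀ s ∈ S, G.Adj u s ∧ ¬G.Adj v s ∧ s ≠ v

theorem Movable.adjMat_moveNeighbors [Fintype V] [DecidableEq V] {G : SimpleGraph V} {u v : V}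
    {S : Finset V} (hS : Movable G u v S) (huv : u ≠ v) (a b : V) :
    adjMat (G.moveNeighbors u v S) a b = adjMat G a b +
      (if b ∈ S then (if a = v then 1 else 0) - (if a = u then 1 else 0) else 0) +
      (if a ∈ S then (if b = v then 1 else 0) - (if b = u then 1 else 0) else 0) := by
  classical
  have ha := hS a
  have hb := hS b
  have hu : u ∉ S := fun h => (hS u h).1.ne rfl
  have hv : v ∉ S := fun h => (hS v h).2.2 rfl
  have hab := G.adj_comm a b
  have hl := G.loopless.irrefl a
  simp only [adjMat_apply, SimpleGraph.moveNeighbors]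
  by_cases h1 : a ∈ S <;> by_cases h2 : b ∈ S <;> by_cases h3 : a = u <;> by_cases h4 : a = v <;>
    by_cases h5 : b = u <;> by_cases h6 : b = v <;> by_cases h7 : a = b <;> grind

theorem Movable.deg_moveNeighbors [Fintype V] [DecidableEq V] {G : SimpleGraph V} {u v : V}
    {S : Finset V} (hS : Movable G u v S) (huv : u ≠ v) (a : V) :
    (deg (G.moveNeighbors u v S) a : ℝ) = deg G a +
      S.card * ((if a = v then 1 else 0) - (if a = u then 1 else 0)) := by
  simp only [deg_eq_sum_adjMat, hS.adjMat_moveNeighbors huv, Finset.sum_add_distrib]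
  have h : ∑ b, (if a ∈ S then (if b = v then (1 : ℝ) else 0) - (if b = u then 1 else 0) else 0)
      = 0 := by
    split_ifs <;> simp
  rw [h]
  simp [mul_sub]

theorem Movable.degMultiset_moveNeighbors [Fintype V] [DecidableEq V] {G : SimpleGraph V}
    {u v : V} {S : Finset V} (hS : Movable G u v S) (huv : u ≠ v)
    (hcard : deg G u = deg G v + S.card) :
    degMultiset (G.moveNeighbors u v S) = degMultiset G := by
  have h : deg (G.moveNeighbors u v S) = deg G ∘ Equiv.swap u v := by
    ext a
    have h1 := hS.deg_moveNeighbors huv a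
    have h2 : (deg G u : ℝ) = deg G v + S.card := by exact_mod_cast hcard
    rw [Function.comp_apply, ← Nat.cast_inj (R := ℝ), h1]
    rcases eq_or_ne a u with rfl | hau
    · simp [huv, h2]
    rcases eq_or_ne a v with rfl | hav
    · simp [huv.symm, h2]
    · simp [hau, hav, Equiv.swap_apply_of_ne_of_ne hau hav]
  unfold degMultiset
  rw [h, ← Multiset.map_map, Multiset.map_univ_val_equiv]

theorem Movable.dotProduct_adjMat_moveNeighbors [Fintype V] [DecidableEq V] {G : SimpleGraph V}
    {u v : V} {S : Finset V} (hS : Movable G u v S) (huv : u ≠ v) (f : V → ℝ) :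
    f ⬝ᵥ (adjMat (G.moveNeighbors u v S)).mulVec f =
      f ⬝ᵥ (adjMat G).mulVec f + 2 * (f v - f u) * ∑ s ∈ S, f s := by
  have h1 : ∑ a, ∑ b, f a * ((if b ∈ S then (if a = v then (1 : ℝ) else 0) -
      (if a = u then 1 else 0) else 0) * f b) = (f v - f u) * ∑ s ∈ S, f s := by
    have : ∀ a b, f a * ((if b ∈ S then (if a = v then (1 : ℝ) else 0) -
        (if a = u then 1 else 0) else 0) * f b) =
        ((if a = v then f a else 0) - (if a = u then f a else 0)) *
          (if b ∈ S then f b else 0) := by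
      intro a b
      split_ifs <;> ring
    simp only [this, ← Finset.mul_sum, ← Finset.sum_mul]
    simp
  have h2 : ∑ a, ∑ b, f a * ((if a ∈ S then (if b = v then (1 : ℝ) else 0) -
      (if b = u then 1 else 0) else 0) * f b) = (f v - f u) * ∑ s ∈ S, f s := by
    rw [Finset.sum_comm, ← h1]
    refine Finset.sum_congr rfl fun a _ => Finset.sum_congr rfl fun b _ => by ring
  simp only [dotProduct, Matrix.mulVec, Finset.mul_sum, hS.adjMat_moveNeighbors huv, add_mul,
    mul_add, Finset.sum_add_distrib] at h1 h2 ⊢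
  rw [h1, h2, add_assoc, ← Finset.sum_add_distrib]
  congr 1
  exact Finset.sum_congr rfl fun s _ => by ring

theorem Movable.connected_moveNeighbors {G : SimpleGraph V} (hconn : G.Connected)
    {u v : V} {S : Finset V} (hS : Movable G u v S)
    (hreach : (G.moveNeighbors u v S).Reachable u v) : (G.moveNeighbors u v S).Connected := by
  have hadj : ∀ s ∈ S, (G.moveNeighbors u v S).Reachable u s := fun s hs =>
    hreach.trans (SimpleGraph.Adj.reachable ⟨(hS s hs).2.2.symm, Or.inr (Or.inl ⟨rfl, hs⟩)⟩)
  have hstep : ∀ a b, G.Adj a b → (G.moveNeighbors u v S).Reachable a b := by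
    intro a b hab
    by_cases h1 : a = u ∧ b ∈ S
    · obtain ⟨rfl, hb⟩ := h1
      exact hadj b hb
    by_cases h2 : b = u ∧ a ∈ S
    · obtain ⟨rfl, ha⟩ := h2
      exact (hadj a ha).symm
    exact SimpleGraph.Adj.reachable ⟨hab.ne, Or.inl ⟨hab, h1, h2⟩⟩
  have := hconn.nonempty
  refine ⟨fun a b => ?_⟩
  obtain ⟨p⟩ := hconn.preconnected a b
  induction p with
  | nil => exact .refl _
  | cons h _ ih => exact (hstep _ _ h).trans ih

/-- An edge of `G` survives in `G.moveNeighbors u v S` if it is not an edge from `u` to `S`. -/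
theorem SimpleGraph.Adj.moveNeighbors {G : SimpleGraph V} {a b u v : V} {S : Finset V}
    (h : G.Adj a b) (h1 : ¬(a = u ∧ b ∈ S)) (h2 : ¬(b = u ∧ a ∈ S)) :
    (G.moveNeighbors u v S).Adj a b :=
  ⟨h.ne, Or.inl ⟨h, h1, h2⟩⟩

/-- A walk avoiding `u` survives in `G.moveNeighbors u v S`. -/
theorem SimpleGraph.Walk.reachable_moveNeighbors {G : SimpleGraph V} {a b u v : V}
    {S : Finset V} (p : G.Walk a b) (hp : u ∉ p.support) :
    (G.moveNeighbors u v S).Reachable a b := by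
  induction p with
  | nil => exact .refl _
  | cons h p ih =>
    simp only [SimpleGraph.Walk.support_cons, List.mem_cons, not_or] at hp
    refine (SimpleGraph.Adj.reachable (h.moveNeighbors (fun h => hp.1 h.1.symm) ?_)).trans
      (ih hp.2)
    rintro ⟨rfl, -⟩
    exact hp.2 p.start_mem_support

/-- In a connected graph, one can move exactly `deg G u - deg G v` neighbors of `u` to `v`
while keeping `u` and `v` in the same component. -/
theorem exists_movable [Fintype V] [DecidableEq V] {G : SimpleGraph V} (hconn : G.Connected)
    {u v : V} (hdeg : deg G v < deg G u) :
    ∃ S : Finset V, Movable G u v S ∧ deg G u = deg G v + S.card ∧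
      (G.moveNeighbors u v S).Reachable u v := by
  classical
  have huv : u ≠ v := by
    rintro rfl
    exact hdeg.false
  have hdu : deg G u = (G.neighborFinset u).card := by
    unfold deg
    rw [← SimpleGraph.card_neighborFinset_eq_degree]
  have hdv : deg G v = (G.neighborFinset v).card := by
    unfold deg
    rw [← SimpleGraph.card_neighborFinset_eq_degree]
  by_cases hnear : G.Adj u v ∨ ∃ w, G.Adj u w ∧ G.Adj v w
  · have hle : (G.neighborFinset u).card - (G.neighborFinset v).card ≤
        (G.neighborFinset u \ insert v (G.neighborFinset v)).card := by
      by_cases hadj : G.Adj u v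
      · have h1 : (insert v (G.neighborFinset v)).erase u ∩ G.neighborFinset u =
            insert v (G.neighborFinset v) ∩ G.neighborFinset u := by
          ext x
          simp only [Finset.mem_inter, Finset.mem_erase, SimpleGraph.mem_neighborFinset]
          constructor
          · tauto
          · rintro ⟨h, h'⟩
            exact ⟨⟨h'.ne.symm, h⟩, h'⟩
        have h2 := Finset.card_le_card
          (Finset.inter_subset_left (s₁ := (insert v (G.neighborFinset v)).erase u)
            (s₂ := G.neighborFinset u))
        rw [h1, Finset.card_erase_of_mem (by simp [hadj.symm]),
          Finset.card_insert_of_notMem (by simp)] at h2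
        rw [Finset.card_sdiff]
        omega
      · rw [Finset.sdiff_insert, Finset.erase_eq_of_notMem (by simp [hadj])]
        exact Finset.le_card_sdiff _ _
    obtain ⟨S, hS, hcard⟩ := Finset.exists_subset_card_eq hle
    have hmov : Movable G u v S := by
      intro s hs
      have := hS hs
      simp only [Finset.mem_sdiff, Finset.mem_insert, SimpleGraph.mem_neighborFinset,
        not_or] at this
      tauto
    have hu : u ∉ S := fun h => (hmov u h).1.ne rfl
    have hv : v ∉ S := fun h => (hmov v h).2.2 rfl
    refine ⟨S, hmov, by omega, ?_⟩
    rcases hnear with h | ⟨w, huw, hvw⟩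
    · exact SimpleGraph.Adj.reachable (h.moveNeighbors (fun h => hv h.2) (fun h => hu h.2))
    · have hw : w ∉ S := fun h => (hmov w h).2.1 hvw
      exact (SimpleGraph.Adj.reachable
          (huw.moveNeighbors (fun h => hw h.2) (fun h => hu h.2))).trans
        (SimpleGraph.Adj.reachable
          (hvw.moveNeighbors (fun h => hw h.2) (fun h => hv h.2))).symm
  · push Not at hnear
    obtain ⟨p, hp⟩ := (hconn.preconnected u v).exists_isPath
    cases p with
    | nil => exact absurd rfl huv
    | @cons _ w _ h p =>
      rw [SimpleGraph.Walk.cons_isPath_iff] at hp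
      have hpos : 0 < (G.neighborFinset v).card := by
        obtain ⟨x, hx⟩ : ∃ x, G.Adj v x := by
          have : Nontrivial V := ⟨u, v, huv⟩
          exact hconn.preconnected.exists_adj_of_nontrivial v
        exact Finset.card_pos.mpr ⟨x, by simpa using hx⟩
      have hle : (G.neighborFinset u).card - (G.neighborFinset v).card ≤
          ((G.neighborFinset u).erase w).card := by
        rw [Finset.card_erase_of_mem (by simpa using h)]
        omega
      obtain ⟨S, hS, hcard⟩ := Finset.exists_subset_card_eq hle
      have hmov : Movable G u v S := by
        intro s hs
        have hus : G.Adj u s := by simpa using Finset.mem_of_mem_erase (hS hs)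
        refine ⟨hus, hnear.2 s hus, ?_⟩
        rintro rfl
        exact hnear.1 hus
      have hu : u ∉ S := fun h => (hmov u h).1.ne rfl
      have hw : w ∉ S := fun h => Finset.ne_of_mem_erase (hS h) rfl
      refine ⟨S, hmov, by omega, ?_⟩
      exact (SimpleGraph.Adj.reachable
          (h.moveNeighbors (fun h => hw h.2) (fun h => hu h.2))).trans
        (p.reachable_moveNeighbors hp.2)

/-- If the Perron vector `f` of a connected graph `G` satisfies
`f(u) < f(v)` for vertices with `d(u) > d(v)`, then `G` does not have greatest
spectral radius among connected graphs with its degree sequence. -/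
theorem shifting_test [Fintype V] [DecidableEq V]
    (G : SimpleGraph V) (hconn : G.Connected)
    (f : V → ℝ) (hf : IsPerronVector G f) (u v : V)
    (hdeg : deg G v < deg G u) (hfuv : f u < f v) :
    ∃ G' : SimpleGraph V, G'.Connected ∧ degMultiset G' = degMultiset G ∧
      specRad G < specRad G' := by
  have huv : u ≠ v := by
    rintro rfl
    exact hdeg.false
  obtain ⟨hpos, hunit, heig⟩ := hf
  obtain ⟨S, hS, hcard, hreach⟩ := exists_movable hconn hdeg
  refine ⟨G.moveNeighbors u v S, hS.connected_moveNeighbors hconn hreach,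
    hS.degMultiset_moveNeighbors huv hcard, ?_⟩
  have hle : f ⬝ᵥ (adjMat (G.moveNeighbors u v S)).mulVec f ≤
      specRad (G.moveNeighbors u v S) :=
    (adjMat_isSymm _).dotProduct_mulVec_le_sSup f hunit
  rw [hS.dotProduct_adjMat_moveNeighbors huv, heig, dotProduct_smul] at hle
  have hself : f ⬝ᵥ f = 1 := by simpa [dotProduct, sq] using hunit
  have hsum : 0 < ∑ s ∈ S, f s :=
    Finset.sum_pos (fun s _ => hpos s) (Finset.card_pos.mp (by omega))
  rw [hself, smul_eq_mul, mul_one] at hle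
  have := mul_pos (mul_pos two_pos (sub_pos.mpr hfuv)) hsum
  linarith
end

section
/- Let π and π' be two tree degree sequences with π ◁ π'. Then there exists a finite chain of tree degree sequences π = π_0 ◁ π_1 ◁ ⋯ ◁ π_k = π' such that for each i, the sequences π_{i−1} and π_i differ (after sorting non-increasingly) in exactly two positions, with one entry increased by 1 and another entry decreased by 1. -/
open Finset

variable {V : Type*} {W : Type*}

/-- Partial sums over an initial segment, split off at its last index. -/
lemma sum_Iic_eq_sum_Iio_add {n : ℕ} (f : Fin n → ℕ) (j : Fin n) :
    ∑ i ∈ Finset.Iic j, f i = ∑ i ∈ Finset.Iio j, f i + f j := by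
  rw [← Finset.Iio_insert, Finset.sum_insert (by simp), add_comm]

lemma Fin.Iio_eq_Iic_of_val_add_one_eq {n : ℕ} {i j : Fin n} (h : i.val + 1 = j.val) :
    Finset.Iio j = Finset.Iic i := by
  ext x
  simp only [Finset.mem_Iio, Finset.mem_Iic, Fin.lt_def, Fin.le_def]
  omega

/-- `MajorizedBy d d'` says that every partial sum of `d` is at most that of `d'`. -/
def MajorizedBy {n : ℕ} (d d' : Fin n → ℕ) : Prop :=
  ∀ j : Fin n, ∑ i ∈ Finset.Iic j, d i ≤ ∑ i ∈ Finset.Iic j, d' i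

/-- `e` arises from `d` by increasing one entry by one and decreasing another by one. -/
def IsUnitTransfer {n : ℕ} (d e : Fin n → ℕ) : Prop :=
  ∃ a b : Fin n, a ≠ b ∧ e a = d a + 1 ∧ d b = e b + 1 ∧ ∀ m : Fin n, m ≠ a → m ≠ b → e m = d m

/-- The first position where a majorized sequence differs has a smaller entry, and there is a later
position closing the gap between the partial sums. -/
lemma MajorizedBy.exists_gap {n : ℕ} {d d' : Fin n → ℕ} (hmaj : MajorizedBy d d')
    (hsum : ∑ i, d i = ∑ i, d' i) (hne : d ≠ d') :
    ∃ a b : Fin n, a < b ∧ (∀ i < a, d i = d' i) ∧ d a < d' a ∧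
      (∀ j, a ≤ j → j < b → ∑ i ∈ Finset.Iic j, d i < ∑ i ∈ Finset.Iic j, d' i) ∧
      ∑ i ∈ Finset.Iic b, d i = ∑ i ∈ Finset.Iic b, d' i := by
  classical
  obtain ⟨x, hx⟩ := Function.ne_iff.mp hne
  obtain ⟨a, ha, hamin⟩ :=
    WellFounded.has_min (wellFounded_lt (α := Fin n)) {i | d i ≠ d' i} ⟨x, hx⟩
  have heq : ∀ i < a, d i = d' i := fun i hi => by
    by_contra h
    exact hamin i h hi
  have hIio : ∑ i ∈ Finset.Iio a, d i = ∑ i ∈ Finset.Iio a, d' i :=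
    Finset.sum_congr rfl fun i hi => heq i (Finset.mem_Iio.mp hi)
  have hda : d a < d' a := by
    have h := hmaj a
    rw [sum_Iic_eq_sum_Iio_add, sum_Iic_eq_sum_Iio_add, hIio] at h
    exact lt_of_le_of_ne (by omega) ha
  have hlast : ∃ b : Fin n, a ≤ b ∧ ∑ i ∈ Finset.Iic b, d i = ∑ i ∈ Finset.Iic b, d' i := by
    have hpos : n - 1 < n := by have := a.isLt; omega
    have huniv : Finset.Iic (⟨n - 1, hpos⟩ : Fin n) = Finset.univ := by
      ext y
      have := y.isLt
      simp only [Finset.mem_Iic, Fin.le_def, Finset.mem_univ, iff_true]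
      omega
    refine ⟨⟨n - 1, hpos⟩, ?_, by rw [huniv, hsum]⟩
    have := a.isLt
    rw [Fin.le_def]
    simp only
    omega
  obtain ⟨b, ⟨hab, hb⟩, hbmin⟩ := WellFounded.has_min (wellFounded_lt (α := Fin n))
    {b | a ≤ b ∧ ∑ i ∈ Finset.Iic b, d i = ∑ i ∈ Finset.Iic b, d' i} hlast
  refine ⟨a, b, lt_of_le_of_ne hab ?_, heq, hda, fun j haj hjb => ?_, hb⟩
  · rintro rfl
    rw [sum_Iic_eq_sum_Iio_add, sum_Iic_eq_sum_Iio_add, hIio] at hb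
    omega
  · exact lt_of_le_of_ne (hmaj j) fun h => hbmin j ⟨haj, h⟩ hjb

/-- A tree degree sequence strictly below another one in the majorization order can be moved
towards it by a unit transfer. -/
lemma IsTreeDegSeq.exists_unitTransfer {n : ℕ} {d d' : Fin n → ℕ} (hd : IsTreeDegSeq d)
    (hd' : IsTreeDegSeq d') (hne : d ≠ d') (hmaj : MajorizedBy d d') :
    ∃ e : Fin n → ℕ, IsTreeDegSeq e ∧ MajorizedBy d e ∧ MajorizedBy e d' ∧ IsUnitTransfer d e ∧
      ∑ j, ∑ i ∈ Finset.Iic j, d i < ∑ j, ∑ i ∈ Finset.Iic j, e i := by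
  classical
  obtain ⟨hanti, hpos, hsum⟩ := hd
  obtain ⟨hanti', hpos', hsum'⟩ := hd'
  obtain ⟨a, b, hab, heq, hda, hgap, hb⟩ := hmaj.exists_gap (hsum.trans hsum'.symm) hne
  have hdb : d' b < d b := by
    have hab' := Fin.lt_def.mp hab
    have hblt := b.isLt
    let p : Fin n := ⟨b.val - 1, by omega⟩
    have hp : p.val + 1 = b.val := by simp only [p]; omega
    have h := hgap p (by rw [Fin.le_def]; omega) (by rw [Fin.lt_def]; omega)
    rw [sum_Iic_eq_sum_Iio_add, sum_Iic_eq_sum_Iio_add, Fin.Iio_eq_Iic_of_val_add_one_eq hp] at hb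
    omega
  have hafter : ∀ j, b < j → d j < d b := by
    intro j hj
    have hj' := Fin.lt_def.mp hj
    have hjlt := j.isLt
    let s : Fin n := ⟨b.val + 1, by omega⟩
    have h := hmaj s
    rw [sum_Iic_eq_sum_Iio_add, sum_Iic_eq_sum_Iio_add,
      Fin.Iio_eq_Iic_of_val_add_one_eq (i := b) (j := s) rfl, hb] at h
    have hsj : d j ≤ d s := hanti (by rw [Fin.le_def]; simp only [s]; omega)
    have hbs : d' s ≤ d' b := hanti' (by rw [Fin.le_def]; simp only [s]; omega)
    omega
  have hbefore : ∀ i < a, d a < d i := fun i hi => by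
    have := hanti' hi.le
    rw [heq i hi]
    omega
  let e : Fin n → ℕ := fun i => if i = a then d a + 1 else if i = b then d b - 1 else d i
  have hea : e a = d a + 1 := by simp [e]
  have heb : d b = e b + 1 := by
    have := hpos b
    simp only [e, hab.ne', if_false, if_true]
    omega
  have hem : ∀ m, m ≠ a → m ≠ b → e m = d m := fun m h₁ h₂ => by simp [e, h₁, h₂]
  have hpt : ∀ i, e i + (if i = b then 1 else 0) = d i + (if i = a then 1 else 0) := by
    intro i
    by_cases h₁ : i = a
    · subst h₁
      simp [hea, hab.ne]
    · by_cases h₂ : i = b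
      · subst h₂
        simp [h₁, heb]
      · simp [h₁, h₂, hem i h₁ h₂]
  have hS : ∀ s : Finset (Fin n), ∑ i ∈ s, e i + (if b ∈ s then 1 else 0)
      = ∑ i ∈ s, d i + (if a ∈ s then 1 else 0) := by
    intro s
    have h := Finset.sum_congr (rfl : s = s) fun i _ => hpt i
    simpa only [Finset.sum_add_distrib, Finset.sum_ite_eq'] using h
  have hde : MajorizedBy d e := by
    intro j
    have h := hS (Finset.Iic j)
    by_cases hbj : b ≤ j
    · simp only [Finset.mem_Iic, hbj, hab.le.trans hbj, if_true] at h
      omega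
    · simp only [Finset.mem_Iic, hbj, if_false] at h
      omega
  refine ⟨e, ⟨?_, ?_, ?_⟩, hde, ?_, ⟨a, b, hab.ne, hea, heb, hem⟩, ?_⟩
  · intro i j hij
    rcases hij.eq_or_lt with rfl | hlt
    · exact le_rfl
    have hdij := hanti hij
    have hi := hpt i
    have hj := hpt j
    by_cases hib : i = b
    · subst hib
      have := hafter j hlt
      have hja : j ≠ a := (hab.trans hlt).ne'
      have := hem j hja hlt.ne'
      omega
    · by_cases hja : j = a
      · subst hja
        have := hbefore i hlt
        have := hem i hlt.ne hib
        omega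
      · simp only [hib, hja, if_false] at hi hj
        omega
  · intro i
    have hi := hpt i
    have hi₁ := hpos i
    have hi₂ := hpos' i
    by_cases hib : i = b
    · subst hib
      omega
    · simp only [hib, if_false] at hi
      omega
  · have h := hS Finset.univ
    simp only [Finset.mem_univ, if_true] at h
    omega
  · intro j
    have h := hS (Finset.Iic j)
    have hj := hmaj j
    by_cases hbj : b ≤ j
    · simp only [Finset.mem_Iic, hbj, hab.le.trans hbj, if_true] at h
      omega
    · by_cases haj : a ≤ j
      · have := hgap j haj (not_le.mp hbj)
        simp only [Finset.mem_Iic, hbj, haj, if_true, if_false] at h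
        omega
      · simp only [Finset.mem_Iic, hbj, haj, if_false] at h
        omega
  · refine Finset.sum_lt_sum (fun j _ => hde j) ⟨a, Finset.mem_univ a, ?_⟩
    have h := hS (Finset.Iic a)
    simp only [Finset.mem_Iic, not_le.mpr hab, le_refl, if_true, if_false] at h
    omega

/-- Majorization between tree degree sequences is realized by a chain of unit transfers. -/
lemma IsTreeDegSeq.exists_chain {n : ℕ} {d d' : Fin n → ℕ} (hd : IsTreeDegSeq d)
    (hd' : IsTreeDegSeq d') (hmaj : MajorizedBy d d') :
    ∃ (k : ℕ) (c : Fin (k + 1) → Fin n → ℕ), c 0 = d ∧ c (Fin.last k) = d' ∧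
      (∀ i, IsTreeDegSeq (c i)) ∧
      ∀ i : Fin k, MajorizedBy (c i.castSucc) (c i.succ) ∧
        IsUnitTransfer (c i.castSucc) (c i.succ) := by
  induction hN : ∑ j, ∑ i ∈ Finset.Iic j, d' i - ∑ j, ∑ i ∈ Finset.Iic j, d i
    using Nat.strong_induction_on generalizing d with
  | _ N ih =>
    by_cases hne : d = d'
    · subst hne
      exact ⟨0, fun _ => d, rfl, rfl, fun _ => hd, fun i => i.elim0⟩
    obtain ⟨e, he, hde, hed', htr, hlt⟩ := hd.exists_unitTransfer hd' hne hmaj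
    have hle : ∑ j, ∑ i ∈ Finset.Iic j, e i ≤ ∑ j, ∑ i ∈ Finset.Iic j, d' i :=
      Finset.sum_le_sum fun j _ => hed' j
    obtain ⟨k, c, hc0, hck, hc, hstep⟩ := ih _ (by omega) he hed' rfl
    refine ⟨k + 1, Fin.cons d c, rfl, ?_, ?_, ?_⟩
    · rw [← Fin.succ_last, Fin.cons_succ, hck]
    · intro i
      refine Fin.cases ?_ (fun i => ?_) i
      · exact hd
      · exact hc i
    · intro i
      refine Fin.cases ?_ (fun i => ?_) i
      · rw [Fin.castSucc_zero, Fin.cons_zero, Fin.cons_succ, hc0]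
        exact ⟨hde, htr⟩
      · rw [Fin.castSucc_succ, Fin.cons_succ, Fin.cons_succ]
        exact hstep i

/-- Any two tree degree sequences `d ◁ d'` are connected by a chain
of tree degree sequences, consecutive members of which differ in exactly two
positions, one entry increased by one and another decreased by one. -/
theorem majorization_chain {n : ℕ}
    (d d' : Fin n → ℕ) (hd : IsTreeDegSeq d) (hd' : IsTreeDegSeq d') (hne : d ≠ d')
    (hmaj : ∀ j : Fin n, ∑ i ∈ Finset.Iic j, d i ≤ ∑ i ∈ Finset.Iic j, d' i) :
    ∃ (k : ℕ) (c : Fin (k + 1) → Fin n → ℕ),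
      c 0 = d ∧ c (Fin.last k) = d' ∧
      (∀ i, IsTreeDegSeq (c i)) ∧
      (∀ i : Fin k,
        (∀ j : Fin n, ∑ m ∈ Finset.Iic j, c i.castSucc m ≤ ∑ m ∈ Finset.Iic j, c i.succ m) ∧
        ∃ a b : Fin n, a ≠ b ∧
          c i.succ a = c i.castSucc a + 1 ∧
          c i.castSucc b = c i.succ b + 1 ∧
          ∀ m : Fin n, m ≠ a → m ≠ b → c i.succ m = c i.castSucc m) := by
  exact hd.exists_chain hd' hmaj
end
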